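/- arXiv:2502.09514 — 4 statements merged into one kernel-verified Lean document; each statement's English description precedes it below -/
import Mathlib

section
/- Analytic core of the quantum Levenshtein bound (Theorem 2): Let N ≥ 1 be an integer, j the first positive zero of J_N, and let d satisfy 0 < d ≤ d₊ where d₊ = (16·N!·|J_{N−1}(j)| / (3·√π·Γ((2N−1)/2)·j^{N−2}))^{1/6}. Let c > 0 and let a : ℝ^{2N} → ℝ be an even, continuous, nonnegative, integrable function with a(0) > 0 such that â(x) ≥ 0 for all x ∈ ℝ^{2N} and c·â(x) ≤ a(x) whenever ‖x‖ < d. Then c·d^{2N} ≤ j^{2N}/(N!·2^N). -/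
open MeasureTheory Real
open scoped RealInnerProductSpace

/-- The Bessel function of the first kind of integer order `ν`, defined by its
everywhere-convergent power series. -/
noncomputable def besselJ (ν : ℕ) (x : ℝ) : ℝ :=
  ∑' k : ℕ, (-1 : ℝ) ^ k / ((k.factorial : ℝ) * ((k + ν).factorial : ℝ)) * (x / 2) ^ (ν + 2 * k)

/-- The Fourier transform of an even integrable function `h : ℝ^{2N} → ℝ`,
`ĥ(y) = (2π)^{-N} ∫ cos⟨y,x⟩ h(x) dx`. -/
noncomputable def fourierCos (N : ℕ) (h : EuclideanSpace ℝ (Fin (2 * N)) → ℝ)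
    (y : EuclideanSpace ℝ (Fin (2 * N))) : ℝ :=
  (1 / (2 * π) ^ N) * ∫ x : EuclideanSpace ℝ (Fin (2 * N)), Real.cos ⟪y, x⟫ * h x

/-- The entire function with `J_ν(x) = (x/2)^ν · besselE ν (x²/4)`. -/
noncomputable def besselE (ν : ℕ) (q : ℝ) : ℝ :=
  ∑' k : ℕ, (-1 : ℝ) ^ k / ((k.factorial : ℝ) * ((k + ν).factorial : ℝ)) * q ^ k

lemma norm_besselE_coeff_le (ν k : ℕ) :
    ‖(-1 : ℝ) ^ k / ((k.factorial : ℝ) * ((k + ν).factorial : ℝ))‖ ≤ 1 / k.factorial := by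
  have h1 : (1 : ℝ) ≤ ((k + ν).factorial : ℝ) := by exact_mod_cast Nat.factorial_pos _
  have h2 : (0 : ℝ) < (k.factorial : ℝ) := by exact_mod_cast Nat.factorial_pos _
  rw [norm_div, norm_pow, norm_neg, norm_one, one_pow, Real.norm_of_nonneg (by positivity)]
  gcongr
  nlinarith

lemma summable_besselE (ν : ℕ) (q : ℝ) : Summable fun k : ℕ ↦
    (-1 : ℝ) ^ k / ((k.factorial : ℝ) * ((k + ν).factorial : ℝ)) * q ^ k := by
  refine Summable.of_norm_bounded (Real.summable_pow_div_factorial ‖q‖) fun k ↦ ?_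
  rw [norm_mul, norm_pow, div_eq_mul_one_div (‖q‖ ^ k), mul_comm]
  exact mul_le_mul_of_nonneg_left (norm_besselE_coeff_le ν k) (by positivity)

lemma besselE_zero (ν : ℕ) : besselE ν 0 = 1 / (ν.factorial : ℝ) := by
  rw [besselE, tsum_eq_single 0 (fun k hk ↦ by simp [hk])]
  simp

lemma besselJ_eq (ν : ℕ) (x : ℝ) : besselJ ν x = (x / 2) ^ ν * besselE ν (x ^ 2 / 4) := by
  rw [besselJ, besselE, ← tsum_mul_left]
  congr 1 with k
  rw [pow_add, pow_mul, show (x / 2) ^ 2 = x ^ 2 / 4 by ring]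
  ring

lemma hasDerivAt_besselE (ν : ℕ) (q : ℝ) :
    HasDerivAt (besselE ν) (-besselE (ν + 1) q) q := by
  set R : ℝ := |q| + 1
  have hbound : Summable fun k : ℕ ↦ (k : ℝ) * R ^ (k - 1) / k.factorial := by
    rw [← summable_nat_add_iff 1]
    refine (Real.summable_pow_div_factorial R).congr fun k ↦ ?_
    rw [Nat.factorial_succ]
    have : (0 : ℝ) < (k.factorial : ℝ) := by exact_mod_cast Nat.factorial_pos _
    push_cast
    field_simp
  have hterm : ∀ (k : ℕ) (y : ℝ), ‖y‖ ≤ R → ‖(-1 : ℝ) ^ k /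
      ((k.factorial : ℝ) * ((k + ν).factorial : ℝ)) * (k * y ^ (k - 1))‖ ≤
      (k : ℝ) * R ^ (k - 1) / k.factorial := fun k y hy ↦ by
    rw [norm_mul, norm_mul, norm_pow, RCLike.norm_natCast, mul_comm,
      div_eq_mul_one_div ((k : ℝ) * R ^ (k - 1))]
    exact mul_le_mul (by gcongr) (norm_besselE_coeff_le ν k) (norm_nonneg _) (by positivity)
  have h := hasDerivAt_tsum_of_isPreconnected (𝕜 := ℝ) (F := ℝ)
    (g := fun (k : ℕ) (q : ℝ) ↦
      (-1 : ℝ) ^ k / ((k.factorial : ℝ) * ((k + ν).factorial : ℝ)) * q ^ k)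
    (g' := fun (k : ℕ) (q : ℝ) ↦
      (-1 : ℝ) ^ k / ((k.factorial : ℝ) * ((k + ν).factorial : ℝ)) * (k * q ^ (k - 1)))
    (t := Metric.ball 0 R) (y₀ := 0) (y := q) hbound Metric.isOpen_ball
    (convex_ball 0 R).isPreconnected
    (fun k y _ ↦ (hasDerivAt_pow k y).const_mul _)
    (fun k y hy ↦ hterm k y (mem_ball_zero_iff.1 hy).le) (by simp [R]; positivity)
    (summable_besselE ν 0) (by simp [R])
  refine h.congr_deriv ?_
  have hs : Summable fun k : ℕ ↦ (-1 : ℝ) ^ k /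
      ((k.factorial : ℝ) * ((k + ν).factorial : ℝ)) * (k * q ^ (k - 1)) :=
    Summable.of_norm_bounded hbound fun k ↦ hterm k q (by simp [R])
  rw [hs.tsum_eq_zero_add, besselE, ← tsum_neg]
  simp only [Nat.cast_zero, zero_mul, mul_zero, zero_add]
  congr 1 with k
  rw [Nat.factorial_succ, show k + 1 + ν = k + (ν + 1) by ring]
  have : (0 : ℝ) < (k.factorial : ℝ) := by exact_mod_cast Nat.factorial_pos _
  have : (0 : ℝ) < ((k + (ν + 1)).factorial : ℝ) := by exact_mod_cast Nat.factorial_pos _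
  push_cast
  field_simp
  ring

lemma continuous_besselE (ν : ℕ) : Continuous (besselE ν) :=
  continuous_iff_continuousAt.2 fun q ↦ (hasDerivAt_besselE ν q).continuousAt

lemma besselE_recurrence (ν : ℕ) (q : ℝ) :
    besselE ν q = (ν + 1) * besselE (ν + 1) q - q * besselE (ν + 2) q := by
  have h1 := (summable_besselE ν q)
  have h2 := (summable_besselE (ν + 1) q)
  simp only [besselE]
  rw [h1.tsum_eq_zero_add, h2.tsum_eq_zero_add, mul_add, add_sub_assoc,
    ← tsum_mul_left, ← tsum_mul_left, ← Summable.tsum_sub]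
  · congr 1
    · have : (0 : ℝ) < (ν.factorial : ℝ) := by exact_mod_cast Nat.factorial_pos _
      simp [Nat.factorial_succ]
      field_simp
    · congr 1 with k
      have h : (k + 1 + (ν + 1)).factorial = (k + 1 + ν + 1) * (k + 1 + ν).factorial :=
        Nat.factorial_succ _
      rw [h, show k + (ν + 2) = k + 1 + (ν + 1) by ring, h, Nat.factorial_succ k]
      have : (0 : ℝ) < (k.factorial : ℝ) := by exact_mod_cast Nat.factorial_pos _
      have : (0 : ℝ) < ((k + 1 + ν).factorial : ℝ) := by exact_mod_cast Nat.factorial_pos _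
      push_cast
      field_simp
      ring
  · exact ((summable_nat_add_iff 1).2 h2).mul_left _
  · exact (summable_besselE (ν + 2) q).mul_left _

lemma hasDerivAt_pow_mul_besselE (ν : ℕ) (q : ℝ) :
    HasDerivAt (fun q ↦ q ^ (ν + 1) * besselE (ν + 1) q) (q ^ ν * besselE ν q) q := by
  refine ((hasDerivAt_pow (ν + 1) q).mul (hasDerivAt_besselE (ν + 1) q)).congr_deriv ?_
  rw [besselE_recurrence ν q]
  push_cast
  ring

lemma besselE_succ_pos {ν : ℕ} {Q : ℝ} (h : ∀ q, 0 ≤ q → q < Q → 0 < besselE ν q) :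
    ∀ q, 0 ≤ q → q ≤ Q → 0 < besselE (ν + 1) q := by
  intro q hq hqQ
  rcases hq.eq_or_lt with rfl | hq
  · rw [besselE_zero]; positivity
  have hmono : StrictMonoOn (fun q ↦ q ^ (ν + 1) * besselE (ν + 1) q) (Set.Icc 0 Q) := by
    refine strictMonoOn_of_hasDerivWithinAt_pos (f' := fun q ↦ q ^ ν * besselE ν q)
      (convex_Icc 0 Q) (fun x _ ↦ (hasDerivAt_pow_mul_besselE ν x).continuousAt.continuousWithinAt)
      (fun x _ ↦ (hasDerivAt_pow_mul_besselE ν x).hasDerivWithinAt) fun x hx ↦ ?_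
    rw [interior_Icc] at hx
    have := h x hx.1.le hx.2
    have := hx.1
    positivity
  have := hmono ⟨le_rfl, hq.le.trans hqQ⟩ ⟨hq.le, hqQ⟩ hq
  simp only [ne_eq, Nat.add_eq_zero_iff, one_ne_zero, and_false, not_false_eq_true, zero_pow,
    zero_mul] at this
  exact pos_of_mul_pos_right this (by positivity)

lemma besselE_pos_of_ne_zero {ν : ℕ} {Q : ℝ} (h : ∀ q, 0 < q → q < Q → besselE ν q ≠ 0) :
    ∀ q, 0 ≤ q → q < Q → 0 < besselE ν q := by
  intro q hq hqQ
  have h0 : 0 < besselE ν 0 := by rw [besselE_zero]; positivity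
  by_contra! hneg
  obtain ⟨x, hx, hx0⟩ := intermediate_value_Icc' hq (continuous_besselE ν).continuousOn
    (show (0 : ℝ) ∈ Set.Icc _ _ from ⟨hneg, h0.le⟩)
  have : x ≠ 0 := by rintro rfl; exact h0.ne' hx0
  exact h x (lt_of_le_of_ne hx.1 this.symm) (hx.2.trans_lt hqQ) hx0

/-- Below its first zero `Q`, the function `besselE ν` lies under the chord from `0` to `Q`. -/
lemma factorial_mul_besselE_le {ν : ℕ} {Q : ℝ} (hQ : 0 < Q) (hz : besselE ν Q = 0)
    (h : ∀ q, 0 ≤ q → q < Q → 0 < besselE ν q) {q : ℝ} (hq : 0 ≤ q) (hqQ : q ≤ Q) :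
    ν.factorial * besselE ν q ≤ 1 - q / Q := by
  have h1 := besselE_succ_pos h
  have h2 := besselE_succ_pos fun q hq hq' ↦ h1 q hq hq'.le
  have hconv : ConvexOn ℝ (Set.Icc 0 Q) (besselE ν) := by
    refine convexOn_of_hasDerivWithinAt2_nonneg (f' := fun q ↦ -besselE (ν + 1) q)
      (convex_Icc 0 Q) (continuous_besselE ν).continuousOn
      (fun x _ ↦ (hasDerivAt_besselE ν x).hasDerivWithinAt)
      (fun x _ ↦ ((hasDerivAt_besselE (ν + 1) x).neg.congr_deriv (neg_neg _)).hasDerivWithinAt)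
      fun x hx ↦ ?_
    rw [interior_Icc] at hx
    exact (h2 x hx.1.le hx.2.le).le
  have := hconv.2 (Set.left_mem_Icc.2 hQ.le) (Set.right_mem_Icc.2 hQ.le)
    (show 0 ≤ 1 - q / Q by rw [sub_nonneg, div_le_one hQ]; exact hqQ)
    (show 0 ≤ q / Q by positivity) (by ring)
  simp only [smul_eq_mul, mul_zero, zero_add, hz, add_zero, besselE_zero,
    div_mul_cancel₀ q hQ.ne'] at this
  have hf : (0 : ℝ) < (ν.factorial : ℝ) := by exact_mod_cast Nat.factorial_pos _
  calc ν.factorial * besselE ν q ≤ ν.factorial * ((1 - q / Q) * (1 / ν.factorial)) := by gcongr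
    _ = 1 - q / Q := by field_simp

lemma besselE_neg_at_zero_succ {ν : ℕ} {Q : ℝ} (hQ : 0 < Q) (hz : besselE (ν + 1) Q = 0)
    (h : ∀ q, 0 ≤ q → q < Q → 0 < besselE (ν + 1) q) : besselE ν Q < 0 := by
  have := besselE_succ_pos h Q hQ.le le_rfl
  rw [besselE_recurrence, hz]
  nlinarith

lemma besselE_antitoneOn {ν : ℕ} {Q : ℝ} (h : ∀ q, 0 ≤ q → q < Q → 0 < besselE (ν + 1) q) :
    AntitoneOn (besselE ν) (Set.Icc 0 Q) := by
  refine antitoneOn_of_hasDerivWithinAt_nonpos (f' := fun q ↦ -besselE (ν + 1) q)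
    (convex_Icc 0 Q) (continuous_besselE ν).continuousOn
    (fun x _ ↦ (hasDerivAt_besselE ν x).hasDerivWithinAt) fun x hx ↦ ?_
  rw [interior_Icc] at hx
  simpa using (h x hx.1.le hx.2).le

lemma integral_even_pow_mul_exp_neg_sq (k : ℕ) :
    ∫ t : ℝ, t ^ (2 * k) * exp (-t ^ 2) = (2 * k).factorial * √π / (4 ^ k * k.factorial) := by
  have h := integral_comp_abs (f := fun t : ℝ ↦ t ^ (2 * k) * exp (-t ^ 2))
  simp only [sq_abs, (even_two_mul k).pow_abs] at h
  have h2 := integral_rpow_mul_exp_neg_mul_rpow (p := 2) (q := (2 * k : ℕ)) (b := 1)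
    (by norm_num) (by linarith [Nat.cast_nonneg (α := ℝ) (2 * k)]) one_pos
  simp only [rpow_natCast, rpow_ofNat, neg_mul, one_mul, one_rpow] at h2
  rw [h, h2, show (((2 * k : ℕ) : ℝ) + 1) / 2 = k + 1 / 2 by push_cast; ring,
    Gamma_nat_add_half]
  have hd : ((2 * k).factorial : ℝ) = 2 ^ k * k.factorial * (2 * k - 1).doubleFactorial := by
    cases k with
    | zero => simp
    | succ m =>
      have := Nat.factorial_eq_mul_doubleFactorial (2 * m + 1)
      rw [show 2 * m + 1 + 1 = 2 * (m + 1) by ring, Nat.doubleFactorial_two_mul] at this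
      rw [this, show 2 * (m + 1) - 1 = 2 * m + 1 by omega]
      push_cast
      ring
  have : (0 : ℝ) < k.factorial := by exact_mod_cast Nat.factorial_pos _
  rw [hd, show (4 : ℝ) ^ k = 2 ^ k * 2 ^ k by rw [← mul_pow]; norm_num]
  field_simp

lemma integral_Ioi_odd_pow_mul_exp_neg_sq (m : ℕ) :
    ∫ r in Set.Ioi (0 : ℝ), r ^ (2 * m + 1) * exp (-r ^ 2) = m.factorial / 2 := by
  have h2 := integral_rpow_mul_exp_neg_mul_rpow (p := 2) (q := (2 * m + 1 : ℕ)) (b := 1)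
    (by norm_num) (by linarith [Nat.cast_nonneg (α := ℝ) (2 * m + 1)]) one_pos
  simp only [rpow_natCast, rpow_ofNat, neg_mul, one_mul, one_rpow] at h2
  rw [h2, show (((2 * m + 1 : ℕ) : ℝ) + 1) / 2 = m + 1 by push_cast; ring, Gamma_nat_eq_factorial]
  ring

section Sphere

variable {E : Type*} [NormedAddCommGroup E] [InnerProductSpace ℝ E] [FiniteDimensional ℝ E]
  [MeasurableSpace E] [BorelSpace E]

lemma integral_inner_pow_mul_exp_neg_sq_norm {n : ℕ} (hE : Module.finrank ℝ E = n + 1)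
    (y : E) (k : ℕ) :
    ∫ x : E, ⟪y, x⟫ ^ (2 * k) * exp (-‖x‖ ^ 2) =
      ‖y‖ ^ (2 * k) * ((2 * k).factorial * √π ^ (n + 1) / (4 ^ k * k.factorial)) := by
  obtain ⟨e, he, hy⟩ : ∃ e : E, ‖e‖ = 1 ∧ y = ‖y‖ • e := by
    by_cases hy : y = 0
    · have : Nontrivial E := Module.nontrivial_of_finrank_pos (R := ℝ) (by omega)
      obtain ⟨e, he⟩ := exists_norm_eq E zero_le_one
      exact ⟨e, he, by simp [hy]⟩
    · exact ⟨‖y‖⁻¹ • y, by simp [norm_smul, hy], by simp [hy]⟩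
  obtain ⟨b, hb⟩ := Orthonormal.exists_orthonormalBasis_extension_of_card_eq (𝕜 := ℝ) (E := E)
    (ι := Fin (n + 1)) (by simpa using hE) (v := fun _ ↦ e) (s := {0})
    ⟨fun _ ↦ by simpa using he, fun i j hij ↦ absurd (Subsingleton.elim i j) hij⟩
  have hb0 : b 0 = e := hb 0 rfl
  have h1 : ∫ x : E, ⟪y, x⟫ ^ (2 * k) * exp (-‖x‖ ^ 2) =
      ∫ x : EuclideanSpace ℝ (Fin (n + 1)), (‖y‖ * x 0) ^ (2 * k) * exp (-‖x‖ ^ 2) := by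
    rw [← b.measurePreserving_repr.integral_comp b.repr.toHomeomorph.measurableEmbedding]
    congr 1 with x
    rw [b.repr.norm_map, b.repr_apply_apply, hb0]
    nth_rw 1 [hy]
    rw [real_inner_smul_left]
  rw [h1, ← (PiLp.volume_preserving_toLp (Fin (n + 1))).integral_comp
    (MeasurableEquiv.toLp 2 _).measurableEmbedding]
  have h2 : ∀ x : Fin (n + 1) → ℝ, (‖y‖ * (WithLp.toLp 2 x) 0) ^ (2 * k) *
      exp (-‖WithLp.toLp 2 x‖ ^ 2) = ‖y‖ ^ (2 * k) *
      ∏ i, (if i = 0 then fun t : ℝ ↦ t ^ (2 * k) * exp (-t ^ 2) else fun t ↦ exp (-t ^ 2))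
        (x i) := fun x ↦ by
    rw [EuclideanSpace.norm_sq_eq, Fin.prod_univ_succ, Fin.sum_univ_succ, neg_add, exp_add,
      ← Finset.sum_neg_distrib, exp_sum]
    simp only [norm_eq_abs, sq_abs, Fin.succ_ne_zero, if_false, if_true]
    ring
  simp only [h2]
  rw [integral_const_mul, integral_fintype_prod_volume_eq_prod, Fin.prod_univ_succ]
  simp only [if_true, Fin.succ_ne_zero, if_false, integral_even_pow_mul_exp_neg_sq]
  have h3 : ∫ t : ℝ, exp (-t ^ 2) = √π := by simpa using integral_gaussian 1
  simp only [h3, Finset.prod_const, Finset.card_univ, Fintype.card_fin]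
  ring

variable [Nontrivial E]

lemma integral_eq_integral_sphere_prod (F : E → ℝ) :
    ∫ x, F x = ∫ p, F (p.2.1 • p.1.1) ∂((volume : Measure E).toSphere.prod
      (.volumeIoiPow (Module.finrank ℝ E - 1))) := by
  rw [← (volume : Measure E).measurePreserving_homeomorphUnitSphereProd.integral_comp
    (Homeomorph.measurableEmbedding _)]
  simp only [← homeomorphUnitSphereProd_symm_apply_coe, Homeomorph.symm_apply_apply]
  rw [integral_subtype_comap (measurableSet_singleton _).compl F, restrict_compl_singleton]

lemma integrable_sphere_prod {F : E → ℝ} (hF : Integrable F) :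
    Integrable (fun p ↦ F (p.2.1 • p.1.1)) ((volume : Measure E).toSphere.prod
      (.volumeIoiPow (Module.finrank ℝ E - 1))) := by
  rw [← (volume : Measure E).measurePreserving_homeomorphUnitSphereProd.integrable_comp_emb
    (Homeomorph.measurableEmbedding _)]
  simp only [Function.comp_def, ← homeomorphUnitSphereProd_symm_apply_coe,
    Homeomorph.symm_apply_apply]
  rw [← Function.comp_def F, ← integrableOn_iff_comap_subtypeVal (by measurability), IntegrableOn,
    restrict_compl_singleton]
  exact hF

lemma integral_volumeIoiPow (n : ℕ) (f : ℝ → ℝ) :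
    ∫ r, f r.1 ∂(Measure.volumeIoiPow n) = ∫ r in Set.Ioi (0 : ℝ), r ^ n * f r := by
  simp only [Measure.volumeIoiPow, ENNReal.ofReal]
  rw [integral_withDensity_eq_integral_smul,
    integral_subtype_comap measurableSet_Ioi fun a ↦ Real.toNNReal (a ^ n) • f a,
    setIntegral_congr_fun measurableSet_Ioi fun x hx ↦ ?_]
  · rw [NNReal.smul_def, Real.coe_toNNReal _ (pow_nonneg hx.out.le _), smul_eq_mul]
  · exact (measurable_subtype_coe.pow_const _).real_toNNReal

lemma integral_sphere_inner_pow {n : ℕ} (hE : Module.finrank ℝ E = 2 * (n + 1)) (y : E) (k : ℕ) :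
    ∫ θ, ⟪y, θ.1⟫ ^ (2 * k) ∂(volume : Measure E).toSphere =
      2 * π ^ (n + 1) * ((2 * k).factorial / (k.factorial * (k + n).factorial)) *
        (‖y‖ ^ 2 / 4) ^ k := by
  have h := integral_inner_pow_mul_exp_neg_sq_norm (n := 2 * n + 1) (by rw [hE]; ring) y k
  rw [integral_eq_integral_sphere_prod, hE] at h
  have h1 : ∀ p : Metric.sphere (0 : E) 1 × Set.Ioi (0 : ℝ),
      ⟪y, p.2.1 • p.1.1⟫ ^ (2 * k) * exp (-‖p.2.1 • p.1.1‖ ^ 2) =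
      ⟪y, p.1.1⟫ ^ (2 * k) * (p.2.1 ^ (2 * k) * exp (-p.2.1 ^ 2)) := fun p ↦ by
    rw [norm_smul, norm_eq_of_mem_sphere, mul_one, norm_eq_abs, sq_abs, real_inner_smul_right]
    ring
  simp only [h1] at h
  rw [integral_prod_mul (fun θ : Metric.sphere (0 : E) 1 ↦ ⟪y, θ.1⟫ ^ (2 * k))
    (fun r : Set.Ioi (0 : ℝ) ↦ r.1 ^ (2 * k) * exp (-r.1 ^ 2)),
    integral_volumeIoiPow _ fun r ↦ r ^ (2 * k) * exp (-r ^ 2)] at h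
  simp only [← mul_assoc, ← pow_add] at h
  rw [show 2 * (n + 1) - 1 + 2 * k = 2 * (k + n) + 1 by omega,
    integral_Ioi_odd_pow_mul_exp_neg_sq, show 2 * n + 1 + 1 = 2 * (n + 1) by ring, pow_mul √π,
    sq_sqrt pi_nonneg, pow_mul ‖y‖] at h
  have : (0 : ℝ) < k.factorial := by exact_mod_cast Nat.factorial_pos _
  have : (0 : ℝ) < (k + n).factorial := by exact_mod_cast Nat.factorial_pos _
  rw [div_pow]
  field_simp at h ⊢
  linarith

lemma integral_sphere_cos {n : ℕ} (hE : Module.finrank ℝ E = 2 * (n + 1)) (y : E) :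
    ∫ θ, cos ⟪y, θ.1⟫ ∂(volume : Measure E).toSphere =
      2 * π ^ (n + 1) * besselE n (‖y‖ ^ 2 / 4) := by
  have h := hasSum_integral_of_dominated_convergence (μ := (volume : Measure E).toSphere)
    (F := fun (k : ℕ) (θ : Metric.sphere (0 : E) 1) ↦
      (-1) ^ k * ⟪y, θ.1⟫ ^ (2 * k) / (2 * k).factorial) (f := fun θ ↦ cos ⟪y, θ.1⟫)
    (fun k _ ↦ ‖y‖ ^ (2 * k) / (2 * k).factorial)
    (fun k ↦ Continuous.aestronglyMeasurable (by fun_prop))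
    (fun k ↦ .of_forall fun θ ↦ ?_)
    (.of_forall fun θ ↦ (Real.summable_pow_div_factorial ‖y‖).comp_injective
      (mul_right_injective₀ two_ne_zero)) (integrable_const _)
    (.of_forall fun θ ↦ hasSum_cos _)
  · rw [← h.tsum_eq, besselE, ← tsum_mul_left]
    congr 1 with k
    rw [integral_div, integral_const_mul, integral_sphere_inner_pow hE]
    have : (0 : ℝ) < (2 * k).factorial := by exact_mod_cast Nat.factorial_pos _
    field_simp
  · rw [norm_div, norm_mul, norm_pow, norm_neg, norm_one, one_pow, one_mul, norm_pow,
      RCLike.norm_natCast]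
    gcongr
    simpa using norm_inner_le_norm (𝕜 := ℝ) y θ.1

/-- The cosine transform of a radial function in even dimension. -/
lemma integral_cos_inner_mul_norm {n : ℕ} (hE : Module.finrank ℝ E = 2 * (n + 1)) (y : E)
    (f : ℝ → ℝ) (hf : Integrable fun x : E ↦ f ‖x‖) :
    ∫ x : E, cos ⟪y, x⟫ * f ‖x‖ = 2 * π ^ (n + 1) *
      ∫ r in Set.Ioi (0 : ℝ), r ^ (2 * n + 1) * (f r * besselE n (r ^ 2 * ‖y‖ ^ 2 / 4)) := by
  have hint : Integrable fun x : E ↦ cos ⟪y, x⟫ * f ‖x‖ :=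
    hf.bdd_mul (c := 1) (Continuous.aestronglyMeasurable (by fun_prop))
      (.of_forall fun x ↦ by simpa using abs_cos_le_one _)
  have h1 := integrable_sphere_prod hint
  rw [integral_eq_integral_sphere_prod, integral_prod_symm _ h1,
    ← integral_const_mul, hE]
  have h2 : ∀ r : Set.Ioi (0 : ℝ), ∫ θ : Metric.sphere (0 : E) 1,
      cos ⟪y, r.1 • θ.1⟫ * f ‖r.1 • θ.1‖ ∂(volume : Measure E).toSphere =
      (fun r ↦ 2 * π ^ (n + 1) * (f r * besselE n (r ^ 2 * ‖y‖ ^ 2 / 4))) r.1 := fun r ↦ by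
    have hr : (0 : ℝ) < r.1 := r.2
    simp only [norm_smul, norm_eq_of_mem_sphere, mul_one, norm_eq_abs, abs_of_pos hr]
    rw [integral_mul_const]
    simp only [real_inner_smul_right, ← real_inner_smul_left]
    rw [integral_sphere_cos hE, norm_smul, mul_pow, norm_eq_abs, sq_abs]
    ring
  simp only [h2]
  rw [integral_volumeIoiPow _ fun r ↦ 2 * π ^ (n + 1) * (f r * besselE n (r ^ 2 * ‖y‖ ^ 2 / 4)),
    show 2 * (n + 1) - 1 = 2 * n + 1 by omega]
  congr 1 with r
  ring

end Sphere

lemma hasDerivAt_besselE_comp (ν : ℕ) (t r : ℝ) :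
    HasDerivAt (fun r ↦ besselE ν (r ^ 2 * t ^ 2 / 4))
      (-(r * t ^ 2 / 2 * besselE (ν + 1) (r ^ 2 * t ^ 2 / 4))) r := by
  have h : HasDerivAt (fun r : ℝ ↦ r ^ 2 * t ^ 2 / 4) (r * t ^ 2 / 2) r :=
    (((hasDerivAt_pow 2 r).mul_const (t ^ 2)).div_const 4).congr_deriv (by push_cast; ring)
  exact ((hasDerivAt_besselE ν _).comp r h).congr_deriv (by ring)

lemma hasDerivAt_pow_mul_besselE_comp (n : ℕ) (t r : ℝ) :
    HasDerivAt (fun r ↦ r ^ (2 * n + 2) * besselE (n + 1) (r ^ 2 * t ^ 2 / 4))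
      (2 * r ^ (2 * n + 1) * besselE n (r ^ 2 * t ^ 2 / 4)) r := by
  refine ((hasDerivAt_pow (2 * n + 2) r).mul (hasDerivAt_besselE_comp (n + 1) t r)).congr_deriv ?_
  rw [besselE_recurrence n, show 2 * n + 2 - 1 = 2 * n + 1 by omega]
  push_cast
  ring

lemma continuous_pow_mul_besselE (n : ℕ) (t : ℝ) :
    Continuous fun r : ℝ ↦ r ^ (2 * n + 1) * besselE n (r ^ 2 * t ^ 2 / 4) := by
  have := continuous_besselE n
  fun_prop

lemma integral_pow_mul_besselE (n : ℕ) (t R : ℝ) :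
    ∫ r in (0 : ℝ)..R, r ^ (2 * n + 1) * besselE n (r ^ 2 * t ^ 2 / 4) =
      R ^ (2 * n + 2) / 2 * besselE (n + 1) (R ^ 2 * t ^ 2 / 4) := by
  rw [intervalIntegral.integral_eq_sub_of_hasDerivAt
    (f := fun r ↦ r ^ (2 * n + 2) * besselE (n + 1) (r ^ 2 * t ^ 2 / 4) / 2)
    (fun r _ ↦ ((hasDerivAt_pow_mul_besselE_comp n t r).div_const 2).congr_deriv (by ring))
    ((continuous_pow_mul_besselE n t).intervalIntegrable _ _)]
  simp
  ring

/-- A Lommel-type integral: `1 - besselE n (r²d²/4) / besselE n (R²d²/4)` inverts the factor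
`1 - t²/d²` in the radial cosine transform. -/
lemma lommel_integral {n : ℕ} {d R : ℝ} (t : ℝ) (hz : besselE (n + 1) (R ^ 2 * d ^ 2 / 4) = 0)
    (hP : besselE n (R ^ 2 * d ^ 2 / 4) ≠ 0) :
    (d ^ 2 - t ^ 2) * ∫ r in (0 : ℝ)..R, r ^ (2 * n + 1) *
      ((1 - besselE n (r ^ 2 * d ^ 2 / 4) / besselE n (R ^ 2 * d ^ 2 / 4)) *
        besselE n (r ^ 2 * t ^ 2 / 4)) =
    d ^ 2 * ∫ r in (0 : ℝ)..R, r ^ (2 * n + 1) * besselE n (r ^ 2 * t ^ 2 / 4) := by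
  set P := besselE n (R ^ 2 * d ^ 2 / 4)
  have hc := continuous_besselE n
  rw [← intervalIntegral.integral_const_mul, ← intervalIntegral.integral_const_mul, ← sub_eq_zero,
    ← intervalIntegral.integral_sub (Continuous.intervalIntegrable (by fun_prop) _ _)
      (Continuous.intervalIntegrable (by fun_prop) _ _)]
  have hderiv (r : ℝ) := ((hasDerivAt_pow_mul_besselE_comp n t r).mul_const (-(t ^ 2 / 2))).sub
    ((((hasDerivAt_pow_mul_besselE_comp n d r).mul (hasDerivAt_besselE_comp n t r)).const_mul
      (d ^ 2)).sub (((hasDerivAt_pow_mul_besselE_comp n t r).mul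
        (hasDerivAt_besselE_comp n d r)).const_mul (t ^ 2)) |>.div_const (2 * P))
  rw [intervalIntegral.integral_eq_sub_of_hasDerivAt
    (fun r _ ↦ (hderiv r).congr_deriv ?_)
    (Continuous.intervalIntegrable (by fun_prop) _ _)]
  · simp only [Pi.mul_apply, Pi.sub_apply, hz]
    change _ - (_ - t ^ 2 * (_ * P)) / _ - _ = _
    simp
    field_simp
    ring
  · field_simp
    ring

lemma integral_ball_cos_mul_norm {E : Type*} [NormedAddCommGroup E] [InnerProductSpace ℝ E]
    [FiniteDimensional ℝ E] [MeasurableSpace E] [BorelSpace E] [Nontrivial E] {n : ℕ}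
    (hE : Module.finrank ℝ E = 2 * (n + 1)) (y : E) {g : ℝ → ℝ} (hg : Continuous g)
    {R : ℝ} (hR : 0 ≤ R) :
    ∫ x in Metric.ball (0 : E) R, cos ⟪y, x⟫ * g ‖x‖ = 2 * π ^ (n + 1) *
      ∫ r in (0 : ℝ)..R, r ^ (2 * n + 1) * (g r * besselE n (r ^ 2 * ‖y‖ ^ 2 / 4)) := by
  have h0 : (fun x : E ↦ (Set.Iio R).indicator g ‖x‖) =
      (Metric.ball (0 : E) R).indicator fun x ↦ g ‖x‖ := by
    ext x; simp [Set.indicator]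
  have h1 := integral_cos_inner_mul_norm hE y ((Set.Iio R).indicator g) (by
    rw [h0, integrable_indicator_iff measurableSet_ball]
    exact ((hg.comp continuous_norm).continuousOn.integrableOn_compact
      (isCompact_closedBall 0 R)).mono_set Metric.ball_subset_closedBall)
  rw [← integral_indicator measurableSet_ball, intervalIntegral.integral_of_le hR,
    integral_Ioc_eq_integral_Ioo, ← integral_indicator measurableSet_Ioo]
  rw [← integral_indicator measurableSet_Ioi] at h1
  convert h1 using 2 with x
  · simp [Set.indicator]
  · congr 1 with r
    by_cases h : 0 < r <;> by_cases h' : r < R <;> simp [Set.indicator, h, h']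

lemma half_mul_besselE_le {n : ℕ} {j : ℝ} (hz : besselE (n + 1) (j ^ 2 / 4) = 0) (r : ℝ) :
    r / 2 * besselE (n + 1) (r ^ 2 / 4) ≤ |r - j| / (2 * (n + 1).factorial) := by
  let E := EuclideanSpace ℝ (Fin (2 * (n + 1)))
  have hE : Module.finrank ℝ E = 2 * (n + 1) := by simp [E]
  have : Nontrivial E := Module.nontrivial_of_finrank_pos (R := ℝ) (by omega)
  obtain ⟨e, he⟩ := exists_norm_eq E zero_le_one
  set σ := (volume : Measure E).toSphere
  have hab (θ : Metric.sphere (0 : E) 1) : |⟪e, θ.1⟫| ≤ 1 := by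
    simpa [he] using abs_real_inner_le_norm e θ.1
  have hint {f : Metric.sphere (0 : E) 1 → ℝ} (hf : Continuous f) : Integrable f σ :=
    hf.integrable_of_hasCompactSupport (HasCompactSupport.of_compactSpace f)
  have hcos (r : ℝ) : ∫ θ, cos (r * ⟪e, θ.1⟫) ∂σ =
      2 * π ^ (n + 1) * besselE n (r ^ 2 * 1 ^ 2 / 4) := by
    have := integral_sphere_cos hE (r • e)
    simpa [real_inner_smul_left, norm_smul, he] using this
  have hsin (r : ℝ) : ∫ θ, ⟪e, θ.1⟫ * sin (r * ⟪e, θ.1⟫) ∂σ =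
      2 * π ^ (n + 1) * (r / 2 * besselE (n + 1) (r ^ 2 / 4)) := by
    have h1 := (hasDerivAt_integral_of_dominated_loc_of_deriv_le (μ := σ) (𝕜 := ℝ)
      (F := fun r θ ↦ cos (r * ⟪e, θ.1⟫)) (F' := fun r θ ↦ -(⟪e, θ.1⟫ * sin (r * ⟪e, θ.1⟫)))
      (bound := fun _ ↦ 1) (x₀ := r) (s := Set.univ) Filter.univ_mem
      (.of_forall fun r ↦ (hint (by fun_prop)).aestronglyMeasurable) (hint (by fun_prop))
      (hint (by fun_prop)).aestronglyMeasurable (.of_forall fun θ r _ ↦ ?_) (integrable_const _)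
      (.of_forall fun θ r _ ↦ ?_)).2
    · simp only [hcos] at h1
      have h2 := h1.unique ((hasDerivAt_besselE_comp n 1 r).const_mul (2 * π ^ (n + 1)))
      rw [integral_neg] at h2
      simp only [one_pow, mul_one] at h2
      linarith
    · rw [norm_neg, norm_mul]
      exact mul_le_one₀ (hab θ) (norm_nonneg _) (abs_sin_le_one _)
    · exact ((hasDerivAt_mul_const ⟪e, θ.1⟫).cos).congr_deriv (by ring)
  have hsq : ∫ θ, ⟪e, θ.1⟫ ^ 2 ∂σ = 2 * π ^ (n + 1) * (1 / (2 * (n + 1).factorial)) := by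
    have := integral_sphere_inner_pow hE e 1
    simp only [mul_one] at this
    rw [this, he, show 1 + n = n + 1 by ring]
    simp
    ring
  have hpi : (0 : ℝ) < 2 * π ^ (n + 1) := by positivity
  refine le_of_mul_le_mul_left ?_ hpi
  calc 2 * π ^ (n + 1) * (r / 2 * besselE (n + 1) (r ^ 2 / 4))
      = ∫ θ, ⟪e, θ.1⟫ * sin (r * ⟪e, θ.1⟫) - ⟪e, θ.1⟫ * sin (j * ⟪e, θ.1⟫) ∂σ := by
        rw [integral_sub (hint (by fun_prop)) (hint (by fun_prop)), hsin, hsin, hz]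
        ring
    _ ≤ ∫ θ, |r - j| * ⟪e, θ.1⟫ ^ 2 ∂σ := by
        refine integral_mono (hint (by fun_prop)) (hint (by fun_prop)) fun θ ↦ ?_
        simp only
        rw [← mul_sub]
        refine (le_abs_self _).trans ?_
        rw [abs_mul, ← sq_abs ⟪e, θ.1⟫, sq, ← mul_assoc, mul_comm]
        gcongr
        refine (abs_sin_sub_sin_le _ _).trans ?_
        rw [← sub_mul, abs_mul]
    _ = 2 * π ^ (n + 1) * (|r - j| / (2 * (n + 1).factorial)) := by
        rw [integral_const_mul, hsq]
        ring

lemma besselE_sub_le {n : ℕ} {j : ℝ} (hz : besselE (n + 1) (j ^ 2 / 4) = 0) {r : ℝ} (hr : r ≤ j) :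
    besselE n (r ^ 2 / 4) - besselE n (j ^ 2 / 4) ≤ (j - r) ^ 2 / (4 * (n + 1).factorial) := by
  have hmono : MonotoneOn (fun r ↦ besselE n (r ^ 2 * 1 ^ 2 / 4) -
      (j - r) ^ 2 / (4 * (n + 1).factorial)) (Set.Iic j) := by
    have hd (r : ℝ) := (hasDerivAt_besselE_comp n 1 r).sub
      ((((hasDerivAt_id r).const_sub j).pow 2).div_const (4 * ((n + 1).factorial : ℝ)))
    refine monotoneOn_of_hasDerivWithinAt_nonneg (convex_Iic j)
      (fun r _ ↦ (hd r).continuousAt.continuousWithinAt)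
      (fun r _ ↦ (hd r).hasDerivWithinAt) fun r hr ↦ ?_
    rw [interior_Iic] at hr
    have h1 := half_mul_besselE_le hz r
    rw [abs_of_neg (sub_neg.2 hr)] at h1
    have h2 : -(r - j) / (2 * ((n + 1).factorial : ℝ)) =
      -((2 : ℕ) * (j - id r) ^ (2 - 1) * -1 / (4 * ((n + 1).factorial : ℝ))) := by
      push_cast
      simp only [id]
      field_simp
      ring
    simp only [one_pow, mul_one] at h1 ⊢
    linarith
  have := hmono hr (Set.mem_Iic.2 le_rfl) hr
  simp only [one_pow, mul_one, sub_self] at this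
  norm_num at this
  linarith

section Inversion

open Filter
open scoped Topology FourierTransform

variable {V : Type*} [NormedAddCommGroup V] [InnerProductSpace ℝ V] [MeasurableSpace V]
  [BorelSpace V] [FiniteDimensional ℝ V]

/-- A nonnegative Fourier transform of an integrable function continuous at the origin is
integrable. -/
lemma integrable_of_fourier_eq_nonneg {f : V → ℂ} (hf : Integrable f) (hf0 : ContinuousAt f 0)
    {g : V → ℝ} (hg : ∀ w, 0 ≤ g w) (hgf : ∀ w, 𝓕 f w = g w) : Integrable g := by
  have hgc : Continuous g := by
    have h : Continuous (𝓕 f) :=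
      VectorFourier.fourierIntegral_continuous Real.continuous_fourierChar continuous_inner hf
    simpa [Function.comp_def, hgf] using Complex.continuous_re.comp h
  have hgb (w : V) : ‖g w‖ ≤ ∫ x, ‖f x‖ := by
    have := VectorFourier.norm_fourierIntegral_le_integral_norm 𝐞 volume (innerₗ V) f w
    rw [show VectorFourier.fourierIntegral 𝐞 volume (innerₗ V) f w = g w from hgf w] at this
    simpa using this
  have hgauss {c : ℝ} (hc : 0 < c) : Integrable fun w : V ↦ exp (-c⁻¹ * ‖w‖ ^ 2) := by
    have := (GaussianFourier.integrable_cexp_neg_mul_sq_norm_add (V := V) (b := (c⁻¹ : ℝ))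
      (by simpa using hc) 0 0).re
    refine this.congr (.of_forall fun w ↦ ?_)
    simp only [zero_mul, add_zero]
    norm_cast
  have hint {c : ℝ} (hc : 0 < c) : Integrable fun w : V ↦ exp (-c⁻¹ * ‖w‖ ^ 2) * g w :=
    (hgauss hc).mul_bdd hgc.aestronglyMeasurable (.of_forall hgb)
  have hlim : Tendsto (fun c : ℝ ↦ ∫ w : V, exp (-c⁻¹ * ‖w‖ ^ 2) * g w) atTop
      (𝓝 (f 0).re) := by
    have h := (Complex.continuous_re.tendsto _).comp (tendsto_integral_gaussian_smul' hf hf0)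
    refine h.congr' ?_
    filter_upwards [Ioi_mem_atTop 0] with c (hc : 0 < c)
    have hJ : Integrable fun w : V ↦ Complex.exp (-(c⁻¹ : ℝ) * ‖w‖ ^ 2) := by
      simpa using! GaussianFourier.integrable_cexp_neg_mul_sq_norm_add (V := V) (b := (c⁻¹ : ℝ))
        (by simpa using hc) 0 0
    have h2 := VectorFourier.integral_fourierIntegral_smul_eq_flip (L := innerₗ V)
      Real.continuous_fourierChar continuous_inner hJ hf
    rw [flip_innerₗ] at h2
    have h3 : ∫ w : V, ((π * c : ℂ) ^ (Module.finrank ℝ V / 2 : ℂ) *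
        Complex.exp (-π ^ 2 * c * ‖0 - w‖ ^ 2)) • f w =
        ∫ w : V, ((exp (-c⁻¹ * ‖w‖ ^ 2) * g w : ℝ) : ℂ) := by
      convert! h2 using 2
      · ext w
        congr 1
        change _ = 𝓕 (fun v : V ↦ Complex.exp (-(c⁻¹ : ℝ) * ‖v‖ ^ 2)) w
        rw [fourier_gaussian_innerProductSpace (by simpa using hc)]
        simp only [Complex.ofReal_inv, div_inv_eq_mul, zero_sub, norm_neg]
        congr 2
        ring
      · ext w
        change _ = _ • 𝓕 f w
        rw [hgf, smul_eq_mul]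
        push_cast
        rfl
    rw [Function.comp_apply, h3, integral_complex_ofReal, Complex.ofReal_re]
  have hfatou := lintegral_liminf_le (μ := (volume : Measure V)) (u := atTop)
    (f := fun (n : ℕ) w ↦ ENNReal.ofReal (exp (-(n : ℝ)⁻¹ * ‖w‖ ^ 2) * g w))
    (fun n ↦ by fun_prop)
  refine ⟨hgc.aestronglyMeasurable, ?_⟩
  rw [hasFiniteIntegral_iff_ofReal (.of_forall hg)]
  have hpt (w : V) :
      liminf (fun n : ℕ ↦ ENNReal.ofReal (exp (-(n : ℝ)⁻¹ * ‖w‖ ^ 2) * g w)) atTop =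
        ENNReal.ofReal (g w) := by
    refine Tendsto.liminf_eq (ENNReal.tendsto_ofReal ?_)
    have h1 : Tendsto (fun n : ℕ ↦ (n : ℝ)⁻¹) atTop (𝓝 0) := tendsto_inv_atTop_nhds_zero_nat
    simpa using (((h1.neg.mul_const (‖w‖ ^ 2)).rexp).mul_const (g w))
  have hL :
      liminf (fun n : ℕ ↦ ∫⁻ w : V, ENNReal.ofReal (exp (-(n : ℝ)⁻¹ * ‖w‖ ^ 2) * g w)) atTop =
        ENNReal.ofReal (f 0).re := by
    refine Tendsto.liminf_eq ?_
    refine (ENNReal.tendsto_ofReal (hlim.comp tendsto_natCast_atTop_atTop)).congr' ?_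
    filter_upwards [Ioi_mem_atTop 0] with n (hn : 0 < n)
    rw [← ofReal_integral_eq_lintegral_ofReal (hint (by exact_mod_cast hn))
      (.of_forall fun w ↦ mul_nonneg (exp_nonneg _) (hg w))]
    rfl
  simp only [hpt, hL] at hfatou
  exact hfatou.trans_lt ENNReal.ofReal_lt_top

lemma fourier_ofReal_of_even {a : V → ℝ} (ha : Integrable a) (heven : ∀ x, a (-x) = a x) (w : V) :
    𝓕 (fun x ↦ (a x : ℂ)) w = ∫ x, cos (2 * π * ⟪w, x⟫) * a x := by
  have hc : Integrable fun x ↦ cos (2 * π * ⟪w, x⟫) * a x :=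
    ha.bdd_mul (c := 1) (Continuous.aestronglyMeasurable (by fun_prop))
      (.of_forall fun x ↦ abs_cos_le_one _)
  have hs : Integrable fun x ↦ sin (2 * π * ⟪w, x⟫) * a x :=
    ha.bdd_mul (c := 1) (Continuous.aestronglyMeasurable (by fun_prop))
      (.of_forall fun x ↦ abs_sin_le_one _)
  have hs0 : ∫ x, sin (2 * π * ⟪w, x⟫) * a x = 0 := by
    have := integral_neg_eq_self (fun x ↦ sin (2 * π * ⟪w, x⟫) * a x) volume
    simp only [inner_neg_right, mul_neg, sin_neg, heven, neg_mul, integral_neg] at this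
    linarith
  have h : ∀ x, Complex.exp (((-2 * π * ⟪x, w⟫ : ℝ) : ℂ) * Complex.I) • (a x : ℂ) =
      ((cos (2 * π * ⟪w, x⟫) * a x : ℝ) : ℂ) -
        ((sin (2 * π * ⟪w, x⟫) * a x : ℝ) : ℂ) * Complex.I := by
    intro x
    rw [Complex.exp_mul_I, ← Complex.ofReal_cos, ← Complex.ofReal_sin, neg_mul, neg_mul, cos_neg,
      sin_neg, real_inner_comm, smul_eq_mul]
    push_cast
    ring
  simp_rw [fourier_eq', h]
  rw [integral_sub hc.ofReal (hs.ofReal.mul_const _), integral_mul_const, integral_complex_ofReal,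
    integral_complex_ofReal, hs0]
  simp

lemma eq_integral_cos_of_even {a : V → ℝ} (hac : Continuous a) (ha : Integrable a)
    (heven : ∀ x, a (-x) = a x) (hnn : ∀ w, 0 ≤ ∫ x, cos (2 * π * ⟪w, x⟫) * a x) :
    Integrable (fun w ↦ ∫ x, cos (2 * π * ⟪w, x⟫) * a x) ∧
      ∀ x, a x = ∫ w, cos (2 * π * ⟪x, w⟫) * ∫ z, cos (2 * π * ⟪w, z⟫) * a z := by
  have hc : Continuous fun x ↦ (a x : ℂ) := by fun_prop
  have hi := integrable_of_fourier_eq_nonneg ha.ofReal hc.continuousAt hnn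
    (fourier_ofReal_of_even ha heven)
  refine ⟨hi, fun x ↦ ?_⟩
  have hF := funext (fourier_ofReal_of_even ha heven)
  have h := congrFun (hc.fourierInv_fourier_eq ha.ofReal (by rw [hF]; exact hi.ofReal)) x
  rw [hF, fourierInv_eq_fourier_neg, fourier_ofReal_of_even hi] at h
  · simpa using (Complex.ofReal_injective h).symm
  · intro w
    simp

end Inversion

section Pairing

variable {V : Type*} [NormedAddCommGroup V] [InnerProductSpace ℝ V] [MeasurableSpace V]
  [BorelSpace V] [FiniteDimensional ℝ V]

lemma integrable_cos_inner_mul (y : V) {f : V → ℝ} (hf : Integrable f) :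
    Integrable fun x ↦ cos ⟪y, x⟫ * f x :=
  hf.bdd_mul (c := 1) (Continuous.aestronglyMeasurable (by fun_prop))
    (.of_forall fun _ ↦ abs_cos_le_one _)

lemma integrable_sin_inner_mul (y : V) {f : V → ℝ} (hf : Integrable f) :
    Integrable fun x ↦ sin ⟪y, x⟫ * f x :=
  hf.bdd_mul (c := 1) (Continuous.aestronglyMeasurable (by fun_prop))
    (.of_forall fun _ ↦ abs_sin_le_one _)

lemma integral_sin_inner_mul_of_even (y : V) {f : V → ℝ} (hf : ∀ x, f (-x) = f x) :
    ∫ x, sin ⟪y, x⟫ * f x = 0 := by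
  have := integral_neg_eq_self (fun x ↦ sin ⟪y, x⟫ * f x) volume
  simp only [inner_neg_right, sin_neg, hf, neg_mul, integral_neg] at this
  linarith

lemma integrable_mul_comp_sub {f g : V → ℝ} (hf : Integrable f) (hg : Integrable g) :
    Integrable (fun p : V × V ↦ f p.2 * g (p.1 - p.2)) (volume.prod volume) :=
  hf.convolution_integrand (ContinuousLinearMap.mul ℝ ℝ) hg

/-- The cosine transform of the convolution of two even functions is the product of their cosine
transforms. -/
lemma integral_cos_inner_mul_convolution (y : V) {f g : V → ℝ} (hf : Integrable f)
    (hg : Integrable g) (hge : ∀ x, g (-x) = g x) :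
    ∫ x, cos ⟪y, x⟫ * ∫ z, f z * g (x - z) =
      (∫ x, cos ⟪y, x⟫ * f x) * ∫ x, cos ⟪y, x⟫ * g x := by
  have hint : Integrable (fun p : V × V ↦ cos ⟪y, p.1⟫ * (f p.2 * g (p.1 - p.2)))
      (volume.prod volume) :=
    (integrable_mul_comp_sub hf hg).bdd_mul (c := 1)
      (Continuous.aestronglyMeasurable (by fun_prop)) (.of_forall fun _ ↦ abs_cos_le_one _)
  generalize hG : ∫ x, cos ⟪y, x⟫ * g x = G
  simp_rw [← integral_const_mul]
  rw [integral_integral_swap hint, ← integral_mul_const]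
  congr 1 with z
  rw [← integral_add_right_eq_self (μ := volume) _ z]
  have h : ∀ x, cos ⟪y, x + z⟫ * (f z * g (x + z - z)) =
      cos ⟪y, z⟫ * f z * (cos ⟪y, x⟫ * g x) - sin ⟪y, z⟫ * f z * (sin ⟪y, x⟫ * g x) := by
    intro x
    rw [inner_add_right, cos_add, add_sub_cancel_right]
    ring
  simp_rw [h]
  rw [integral_sub ((integrable_cos_inner_mul y hg).const_mul _)
    ((integrable_sin_inner_mul y hg).const_mul _), integral_const_mul, integral_const_mul,
    integral_sin_inner_mul_of_even y hge, hG]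
  simp

lemma integral_mul_integral_cos {f g : V → ℝ} (hf : Integrable f) (hg : Integrable g) :
    ∫ x, f x * ∫ y, cos ⟪x, y⟫ * g y = ∫ y, (∫ x, cos ⟪y, x⟫ * f x) * g y := by
  have hint : Integrable (fun p : V × V ↦ cos ⟪p.1, p.2⟫ * (f p.1 * g p.2))
      (volume.prod volume) :=
    (hf.mul_prod hg).bdd_mul (c := 1)
      (Continuous.aestronglyMeasurable (by fun_prop)) (.of_forall fun _ ↦ abs_cos_le_one _)
  calc ∫ x, f x * ∫ y, cos ⟪x, y⟫ * g y = ∫ x, ∫ y, cos ⟪x, y⟫ * (f x * g y) := by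
        simp_rw [← integral_const_mul]
        congr! 4
        ring
    _ = ∫ y, ∫ x, cos ⟪x, y⟫ * (f x * g y) := integral_integral_swap hint
    _ = _ := by
        simp_rw [← integral_mul_const, real_inner_comm]
        congr! 4
        ring

end Pairing

lemma fourierCos_inversion {N : ℕ} {a : EuclideanSpace ℝ (Fin (2 * N)) → ℝ}
    (hac : Continuous a) (ha : Integrable a) (heven : ∀ x, a (-x) = a x)
    (hnn : ∀ x, 0 ≤ fourierCos N a x) :
    Integrable (fourierCos N a) ∧ fourierCos N (fourierCos N a) = a := by
  have hpi : (0 : ℝ) < (2 * π) ^ N := by positivity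
  have hs (w : EuclideanSpace ℝ (Fin (2 * N))) :
      ∫ x, cos (2 * π * ⟪w, x⟫) * a x = (2 * π) ^ N * fourierCos N a ((2 * π) • w) := by
    rw [fourierCos]
    simp_rw [real_inner_smul_left]
    field_simp
  obtain ⟨hi, h⟩ := eq_integral_cos_of_even hac ha heven fun w ↦ by
    rw [hs]; exact mul_nonneg hpi.le (hnn _)
  simp_rw [hs] at hi h
  refine ⟨?_, funext fun x ↦ ?_⟩
  · rw [integrable_const_mul_iff (IsUnit.mk0 _ hpi.ne')] at hi
    rwa [integrable_comp_smul_iff _ _ (by positivity)] at hi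
  · rw [h x, fourierCos]
    have := Measure.integral_comp_smul volume
      (fun y ↦ cos ⟪x, y⟫ * ((2 * π) ^ N * fourierCos N a y)) (2 * π)
    simp_rw [real_inner_smul_right] at this
    rw [this]
    simp_rw [mul_left_comm (cos _), integral_const_mul]
    rw [finrank_euclideanSpace_fin, abs_of_pos (by positivity), smul_eq_mul, pow_mul', sq]
    field_simp

section Ball

variable {E : Type*} [NormedAddCommGroup E] [InnerProductSpace ℝ E]
  [FiniteDimensional ℝ E] [MeasurableSpace E] [BorelSpace E]

lemma integrable_ball_indicator {f : ℝ → ℝ} (hf : Continuous f) (R : ℝ) :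
    Integrable ((Metric.ball (0 : E) R).indicator fun x ↦ f ‖x‖) := by
  rw [integrable_indicator_iff measurableSet_ball]
  exact ((hf.comp continuous_norm).continuousOn.integrableOn_compact
    (isCompact_closedBall 0 R)).mono_set Metric.ball_subset_closedBall

lemma integral_cos_inner_mul_ball_indicator (y : E) (f : ℝ → ℝ) (R : ℝ) :
    ∫ x, cos ⟪y, x⟫ * (Metric.ball (0 : E) R).indicator (fun x ↦ f ‖x‖) x =
      ∫ x in Metric.ball (0 : E) R, cos ⟪y, x⟫ * f ‖x‖ := by
  rw [← integral_indicator measurableSet_ball]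
  congr 1 with x
  by_cases hx : x ∈ Metric.ball (0 : E) R <;> simp [hx]

variable [Nontrivial E]

lemma integral_cos_ball {n : ℕ} (hE : Module.finrank ℝ E = 2 * (n + 1)) {R : ℝ} (hR : 0 ≤ R)
    (y : E) :
    ∫ x, cos ⟪y, x⟫ * (Metric.ball (0 : E) R).indicator (fun _ ↦ 1) x =
      π ^ (n + 1) * R ^ (2 * (n + 1)) * besselE (n + 1) (R ^ 2 * ‖y‖ ^ 2 / 4) := by
  rw [integral_cos_inner_mul_ball_indicator y (fun _ ↦ 1),
    integral_ball_cos_mul_norm hE y continuous_const hR]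
  simp_rw [one_mul, integral_pow_mul_besselE]
  ring

end Ball

/-- `d` and `R` are positive and `R * d` is the first positive zero of the Bessel function of
order `n + 1`. -/
structure IsFirstBesselZero (n : ℕ) (d R : ℝ) : Prop where
  d_pos : 0 < d
  R_pos : 0 < R
  zero : besselE (n + 1) (R ^ 2 * d ^ 2 / 4) = 0
  pos : ∀ q, 0 ≤ q → q < R ^ 2 * d ^ 2 / 4 → 0 < besselE (n + 1) q

/-- The radial profile `1 - besselE n (r²d²/4) / besselE n (R²d²/4)`, vanishing at `r = R`. -/
noncomputable def besselProfile (n : ℕ) (d R r : ℝ) : ℝ :=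
  1 - besselE n (r ^ 2 * d ^ 2 / 4) / besselE n (R ^ 2 * d ^ 2 / 4)

lemma continuous_besselProfile (n : ℕ) (d R : ℝ) : Continuous (besselProfile n d R) := by
  have := continuous_besselE n
  unfold besselProfile
  fun_prop

namespace IsFirstBesselZero

variable {n : ℕ} {d R : ℝ}

lemma besselE_neg (h : IsFirstBesselZero n d R) : besselE n (R ^ 2 * d ^ 2 / 4) < 0 := by
  have := h.R_pos
  have := h.d_pos
  exact besselE_neg_at_zero_succ (by positivity) h.zero h.pos

lemma besselProfile_nonneg (h : IsFirstBesselZero n d R) {r : ℝ} (h0 : 0 ≤ r) (hr : r ≤ R) :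
    0 ≤ besselProfile n d R r := by
  have hq : r ^ 2 * d ^ 2 / 4 ≤ R ^ 2 * d ^ 2 / 4 := by gcongr
  rw [besselProfile, sub_nonneg, div_le_one_of_neg h.besselE_neg]
  exact besselE_antitoneOn h.pos ⟨by positivity, hq⟩ (Set.right_mem_Icc.2 (by positivity)) hq

lemma besselProfile_le (h : IsFirstBesselZero n d R) {r : ℝ} (hr : r ≤ R) :
    besselProfile n d R r ≤
      d ^ 2 / (4 * (n + 1).factorial * -besselE n (R ^ 2 * d ^ 2 / 4)) * (R - r) ^ 2 := by
  have hP := h.besselE_neg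
  have h1 := besselE_sub_le (n := n) (j := R * d) (r := r * d) (by rw [mul_pow]; exact h.zero)
    (mul_le_mul_of_nonneg_right hr h.d_pos.le)
  rw [mul_pow, mul_pow] at h1
  rw [besselProfile]
  generalize besselE n (r ^ 2 * d ^ 2 / 4) = b at *
  generalize besselE n (R ^ 2 * d ^ 2 / 4) = P at *
  have h2 : 1 - b / P = (b - P) / -P := by
    rw [div_neg, sub_div, div_self hP.ne]
    ring
  have h3 : d ^ 2 / (4 * (n + 1).factorial * -P) * (R - r) ^ 2 =
      (R * d - r * d) ^ 2 / (4 * (n + 1).factorial) / -P := by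
    rw [div_div]
    ring
  rw [h2, h3]
  exact div_le_div_of_nonneg_right h1 (by linarith)

variable {E : Type*} [NormedAddCommGroup E] [InnerProductSpace ℝ E]
  [FiniteDimensional ℝ E] [MeasurableSpace E] [BorelSpace E] [Nontrivial E]

lemma integral_cos_besselProfile (h : IsFirstBesselZero n d R)
    (hE : Module.finrank ℝ E = 2 * (n + 1)) (y : E) :
    (1 - ‖y‖ ^ 2 / d ^ 2) * ∫ x, cos ⟪y, x⟫ *
        (Metric.ball (0 : E) R).indicator (fun x ↦ besselProfile n d R ‖x‖) x =
      ∫ x, cos ⟪y, x⟫ * (Metric.ball (0 : E) R).indicator (fun _ ↦ 1) x := by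
  have hl := lommel_integral ‖y‖ h.zero h.besselE_neg.ne
  have hd := h.d_pos
  rw [integral_cos_ball hE h.R_pos.le, integral_cos_inner_mul_ball_indicator,
    integral_ball_cos_mul_norm hE y (continuous_besselProfile n d R) h.R_pos.le]
  rw [integral_pow_mul_besselE] at hl
  simp only [besselProfile]
  generalize ∫ r in (0 : ℝ)..R, r ^ (2 * n + 1) *
    ((1 - besselE n (r ^ 2 * d ^ 2 / 4) / besselE n (R ^ 2 * d ^ 2 / 4)) *
      besselE n (r ^ 2 * ‖y‖ ^ 2 / 4)) = I at *
  have h1 : (1 - ‖y‖ ^ 2 / d ^ 2) * I = (d ^ 2 - ‖y‖ ^ 2) * I / d ^ 2 := by field_simp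
  rw [mul_left_comm, h1, hl]
  field_simp
  ring

/-- The product of the cosine transforms of the ball and of the Bessel profile is bounded by a
truncated parabola. -/
lemma transform_le (h : IsFirstBesselZero n d R) (hE : Module.finrank ℝ E = 2 * (n + 1)) (y : E) :
    (∫ x, cos ⟪y, x⟫ * (Metric.ball (0 : E) R).indicator (fun x ↦ besselProfile n d R ‖x‖) x) *
      ∫ x, cos ⟪y, x⟫ * (Metric.ball (0 : E) R).indicator (fun _ ↦ 1) x ≤
    (π ^ (n + 1) * R ^ (2 * (n + 1)) / (n + 1).factorial) ^ 2 *
      (Metric.ball (0 : E) d).indicator (fun y ↦ 1 - ‖y‖ ^ 2 / d ^ 2) y := by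
  have hX := integral_cos_ball hE h.R_pos.le y
  rw [← h.integral_cos_besselProfile hE y] at hX ⊢
  set W := ∫ x, cos ⟪y, x⟫ *
    (Metric.ball (0 : E) R).indicator (fun x ↦ besselProfile n d R ‖x‖) x
  have hd := h.d_pos
  have hR := h.R_pos
  by_cases hy : ‖y‖ < d
  · have hs : 0 < 1 - ‖y‖ ^ 2 / d ^ 2 := by
      rw [sub_pos, div_lt_one (by positivity)]
      gcongr
    have hq : R ^ 2 * ‖y‖ ^ 2 / 4 < R ^ 2 * d ^ 2 / 4 := by gcongr
    have hb := factorial_mul_besselE_le (by positivity) h.zero h.pos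
      (q := R ^ 2 * ‖y‖ ^ 2 / 4) (by positivity) hq.le
    have hb0 := h.pos (R ^ 2 * ‖y‖ ^ 2 / 4) (by positivity) hq
    rw [show R ^ 2 * ‖y‖ ^ 2 / 4 / (R ^ 2 * d ^ 2 / 4) = ‖y‖ ^ 2 / d ^ 2 by field_simp] at hb
    rw [Set.indicator_of_mem (by simpa using hy)]
    set s := 1 - ‖y‖ ^ 2 / d ^ 2
    set b := besselE (n + 1) (R ^ 2 * ‖y‖ ^ 2 / 4)
    set K := π ^ (n + 1) * R ^ (2 * (n + 1))
    have hK : 0 < K := by positivity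
    have h1 : 0 < s * W := by rw [hX]; positivity
    have h2 : s * W ≤ K / (n + 1).factorial * s := by
      rw [hX, div_mul_eq_mul_div, le_div_iff₀ (by positivity)]
      nlinarith
    have h3 : 0 < W := pos_of_mul_pos_right h1 hs.le
    have h4 : W ≤ K / (n + 1).factorial := by
      rw [mul_comm] at h2; exact le_of_mul_le_mul_right h2 hs
    calc W * (s * W) = W ^ 2 * s := by ring
      _ ≤ _ := by gcongr
  · rw [Set.indicator_of_notMem (by simpa using hy)]
    have hs : 1 - ‖y‖ ^ 2 / d ^ 2 ≤ 0 := by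
      rw [sub_nonpos, one_le_div (by positivity)]
      gcongr
      exact not_lt.1 hy
    nlinarith [mul_nonneg (neg_nonneg.2 hs) (sq_nonneg W)]

end IsFirstBesselZero

section Shell

variable {E : Type*} [NormedAddCommGroup E] [InnerProductSpace ℝ E]
  [FiniteDimensional ℝ E] [MeasurableSpace E] [BorelSpace E]

lemma integrable_shell_indicator {f : ℝ → ℝ} (hf : Continuous f) (a b : ℝ) :
    Integrable fun x : E ↦ (Set.Ico a b).indicator f ‖x‖ := by
  have hm : MeasurableSet ((‖·‖ : E → ℝ) ⁻¹' Set.Ico a b) := measurable_norm measurableSet_Ico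
  change Integrable (((‖·‖ : E → ℝ) ⁻¹' Set.Ico a b).indicator (fun x ↦ f ‖x‖))
  rw [integrable_indicator_iff hm]
  refine ((hf.comp continuous_norm).continuousOn.integrableOn_compact
    (isCompact_closedBall 0 b)).mono_set fun x hx ↦ ?_
  simpa using hx.2.le

lemma integral_shell_sq_le [Nontrivial E] {n : ℕ} (hE : Module.finrank ℝ E = 2 * (n + 1))
    {R t : ℝ} (hR : 0 ≤ R) (ht : 0 ≤ t) :
    ∫ x : E, (Set.Ico (R - t) R).indicator (fun r ↦ (R - r) ^ 2) ‖x‖ ≤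
      2 * π ^ (n + 1) * (R ^ (2 * n + 1) * (t ^ 3 / 3) / n.factorial) := by
  have h := integral_cos_inner_mul_norm hE 0
    ((Set.Ico (R - t) R).indicator (fun r ↦ (R - r) ^ 2))
    (integrable_shell_indicator (by fun_prop) _ _)
  simp only [inner_zero_left, cos_zero, one_mul, norm_zero, ne_eq, OfNat.ofNat_ne_zero,
    not_false_eq_true, zero_pow, mul_zero, zero_div, besselE_zero] at h
  rw [h]
  gcongr
  have hI : ∫ r in Set.Ico (R - t) R, R ^ (2 * n + 1) * ((R - r) ^ 2 * (1 / n.factorial)) =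
      R ^ (2 * n + 1) * (t ^ 3 / 3) / n.factorial := by
    rw [integral_Ico_eq_integral_Ioc, ← intervalIntegral.integral_of_le (by linarith),
      intervalIntegral.integral_const_mul, intervalIntegral.integral_mul_const,
      intervalIntegral.integral_comp_sub_left (fun r ↦ r ^ 2) R, integral_pow]
    simp
    ring
  rw [← hI, ← integral_indicator measurableSet_Ioi, ← integral_indicator measurableSet_Ico]
  refine integral_mono_of_nonneg (.of_forall fun r ↦ ?_) ?_ (.of_forall fun r ↦ ?_)
  · refine Set.indicator_nonneg (fun r hr ↦ ?_) r
    have : (0 : ℝ) < r := hr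
    have := Set.indicator_nonneg (s := Set.Ico (R - t) R) (f := fun r ↦ (R - r) ^ 2)
      (fun _ _ ↦ sq_nonneg _) r
    positivity
  · rw [integrable_indicator_iff measurableSet_Ico]
    exact ((Continuous.continuousOn (by fun_prop)).integrableOn_compact isCompact_Icc).mono_set
      Set.Ico_subset_Icc_self
  · by_cases hr : r ∈ Set.Ico (R - t) R
    · by_cases h0 : r ∈ Set.Ioi 0
      · have : (0 : ℝ) < r := h0
        simp only [Set.indicator_of_mem, hr, h0]
        gcongr
        exact hr.2.le
      · simp only [Set.indicator_of_mem, hr, Set.indicator_of_notMem h0]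
        positivity
    · simp [Set.indicator, hr]

end Shell

namespace IsFirstBesselZero

lemma indicator_besselProfile_nonneg {n : ℕ} {d R : ℝ} {E : Type*} [NormedAddCommGroup E]
    (h : IsFirstBesselZero n d R) (z : E) :
    0 ≤ (Metric.ball (0 : E) R).indicator (fun x ↦ besselProfile n d R ‖x‖) z :=
  Set.indicator_nonneg (fun z hz ↦ h.besselProfile_nonneg (norm_nonneg z)
    (mem_ball_zero_iff.1 hz).le) z

variable {n : ℕ} {d R : ℝ} {E : Type*} [NormedAddCommGroup E] [InnerProductSpace ℝ E]
  [FiniteDimensional ℝ E] [MeasurableSpace E] [BorelSpace E]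

/-- The convolution of the Bessel profile with the indicator of the ball dominates a parabola near
the origin. -/
lemma le_convolution [Nontrivial E] (h : IsFirstBesselZero n d R)
    (hE : Module.finrank ℝ E = 2 * (n + 1))
    (hd5 : d ^ 5 ≤ 6 * n.factorial * -besselE n (R ^ 2 * d ^ 2 / 4) * R) {x : E} (hx : ‖x‖ < d) :
    π ^ (n + 1) * R ^ (2 * (n + 1)) / (n + 1).factorial * (1 - ‖x‖ ^ 2 / d ^ 2) ≤
      ∫ z, (Metric.ball (0 : E) R).indicator (fun x ↦ besselProfile n d R ‖x‖) z *
        (Metric.ball (0 : E) R).indicator (fun _ ↦ 1) (x - z) := by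
  have hd := h.d_pos
  have hR := h.R_pos
  have hP := h.besselE_neg
  set v := (Metric.ball (0 : E) R).indicator (fun x ↦ besselProfile n d R ‖x‖)
  have hv : Integrable v := integrable_ball_indicator (continuous_besselProfile n d R) R
  have hv0 : ∀ z, 0 ≤ v z := h.indicator_besselProfile_nonneg
  have hvB : ∫ z, v z = π ^ (n + 1) * R ^ (2 * (n + 1)) / (n + 1).factorial := by
    have := h.integral_cos_besselProfile hE 0
    rw [integral_cos_ball hE hR.le] at this
    simpa [besselE_zero, div_eq_mul_inv] using this
  set C := d ^ 2 / (4 * (n + 1).factorial * -besselE n (R ^ 2 * d ^ 2 / 4)) with hC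
  have hC0 : 0 ≤ C := by
    have : 0 < -besselE n (R ^ 2 * d ^ 2 / 4) := by linarith
    positivity
  have hle (z : E) : v z - v z * (Metric.ball (0 : E) R).indicator (fun _ ↦ 1) (x - z) ≤
      C * (Set.Ico (R - ‖x‖) R).indicator (fun r ↦ (R - r) ^ 2) ‖z‖ := by
    have hsh := Set.indicator_nonneg (s := Set.Ico (R - ‖x‖) R) (f := fun r ↦ (R - r) ^ 2)
      (fun _ _ ↦ sq_nonneg _) ‖z‖
    by_cases hz : z ∈ Metric.ball (0 : E) R
    · by_cases hxz : x - z ∈ Metric.ball (0 : E) R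
      · rw [Set.indicator_of_mem hxz, mul_one, sub_self]
        positivity
      · rw [Set.indicator_of_notMem hxz, mul_zero, sub_zero]
        rw [mem_ball_zero_iff] at hz hxz
        have hzI : ‖z‖ ∈ Set.Ico (R - ‖x‖) R := ⟨by linarith [norm_sub_le x z], hz⟩
        rw [Set.indicator_of_mem hzI, show v z = besselProfile n d R ‖z‖ from
          Set.indicator_of_mem (mem_ball_zero_iff.2 hz) _]
        exact h.besselProfile_le hz.le
    · rw [show v z = 0 from Set.indicator_of_notMem hz _]
      simpa using mul_nonneg hC0 hsh
  have hprod : Integrable fun z ↦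
      v z * (Metric.ball (0 : E) R).indicator (fun _ ↦ (1 : ℝ)) (x - z) := by
    refine hv.mul_bdd (c := 1) ?_ (.of_forall fun z ↦ ?_)
    · exact ((measurable_const.indicator measurableSet_ball).comp
        (measurable_const.sub measurable_id)).aestronglyMeasurable
    · by_cases hz : x - z ∈ Metric.ball (0 : E) R
      · simp [Set.indicator_of_mem hz]
      · simp [Set.indicator_of_notMem hz]
  have h1 := integral_mono (hv.sub hprod)
    ((integrable_shell_indicator (by fun_prop) _ _).const_mul C) hle
  simp only [Pi.sub_apply] at h1
  rw [integral_sub hv hprod, hvB, integral_const_mul] at h1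
  have h2 := mul_le_mul_of_nonneg_left (integral_shell_sq_le hE hR.le (norm_nonneg x)) hC0
  have h3 : C * (2 * π ^ (n + 1) * (R ^ (2 * n + 1) * (‖x‖ ^ 3 / 3) / n.factorial)) ≤
      π ^ (n + 1) * R ^ (2 * (n + 1)) / (n + 1).factorial * (‖x‖ ^ 2 / d ^ 2) := by
    generalize besselE n (R ^ 2 * d ^ 2 / 4) = P at *
    have hP' : 0 < -P := by linarith
    have e1 : C * (2 * π ^ (n + 1) * (R ^ (2 * n + 1) * (‖x‖ ^ 3 / 3) / n.factorial)) =
        π ^ (n + 1) * R ^ (2 * n + 1) / (n + 1).factorial * (‖x‖ ^ 2 / d ^ 2) *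
          (d ^ 4 * ‖x‖ / (6 * n.factorial * -P)) := by
      rw [hC]
      generalize -P = p at *
      field_simp
      ring
    have e2 : d ^ 4 * ‖x‖ / (6 * n.factorial * -P) ≤ R := by
      rw [div_le_iff₀ (by positivity)]
      calc d ^ 4 * ‖x‖ ≤ d ^ 4 * d := by gcongr
        _ = d ^ 5 := by ring
        _ ≤ _ := by linarith
    rw [e1]
    calc _ ≤ π ^ (n + 1) * R ^ (2 * n + 1) / (n + 1).factorial * (‖x‖ ^ 2 / d ^ 2) * R := by gcongr
      _ = _ := by ring
  rw [mul_sub, mul_one]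
  linarith

end IsFirstBesselZero

lemma integral_parabola_mul_pos {E : Type*} [NormedAddCommGroup E] [MeasureSpace E]
    [BorelSpace E] [(volume : Measure E).IsOpenPosMeasure] {d : ℝ} (hd : 0 < d) {a : E → ℝ}
    (hac : Continuous a) (ha0 : 0 < a 0) (hann : ∀ x, 0 ≤ a x)
    (hi : Integrable fun x ↦
      (Metric.ball (0 : E) d).indicator (fun x ↦ 1 - ‖x‖ ^ 2 / d ^ 2) x * a x) :
    0 < ∫ x, (Metric.ball (0 : E) d).indicator (fun x ↦ 1 - ‖x‖ ^ 2 / d ^ 2) x * a x := by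
  have hpos : ∀ x ∈ Metric.ball (0 : E) d, 0 < 1 - ‖x‖ ^ 2 / d ^ 2 := by
    intro x hx
    rw [mem_ball_zero_iff] at hx
    rw [sub_pos, div_lt_one (by positivity)]
    gcongr
  rw [integral_pos_iff_support_of_nonneg
    (fun x ↦ mul_nonneg (Set.indicator_nonneg (fun x hx ↦ (hpos x hx).le) x) (hann x)) hi]
  refine lt_of_lt_of_le (((isOpen_lt continuous_const hac).inter
    Metric.isOpen_ball).measure_pos volume ⟨0, ha0, Metric.mem_ball_self hd⟩)
    (measure_mono fun x hx ↦ ?_)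
  rw [Function.mem_support, Set.indicator_of_mem hx.2]
  exact ne_of_gt (mul_pos (hpos x hx.2) hx.1)

/-- Linear programming bound: pairing `a` with the convolution of the Bessel profile and the
indicator of the ball bounds the ratio `c` of `a` and its cosine transform `A` near the origin. -/
lemma IsFirstBesselZero.le_of_cos_transform {E : Type*} [NormedAddCommGroup E]
    [InnerProductSpace ℝ E] [FiniteDimensional ℝ E] [MeasurableSpace E] [BorelSpace E]
    [Nontrivial E] {n : ℕ} {d R : ℝ} (h : IsFirstBesselZero n d R) (hE : Module.finrank ℝ E = 2 * (n + 1))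
    (hd5 : d ^ 5 ≤ 6 * n.factorial * -besselE n (R ^ 2 * d ^ 2 / 4) * R)
    {c K : ℝ} (hc : 0 < c) (hK : 0 ≤ K) {a A : E → ℝ} (ha_cont : Continuous a)
    (ha_nonneg : ∀ x, 0 ≤ a x) (ha_int : Integrable a) (ha0 : 0 < a 0) (hA : Integrable A)
    (hA_nonneg : ∀ x, 0 ≤ A x) (haA : ∀ x, a x = K * ∫ y, cos ⟪x, y⟫ * A y)
    (hle : ∀ x, ‖x‖ < d → c * A x ≤ a x) :
    c ≤ K * (π ^ (n + 1) * R ^ (2 * (n + 1)) / (n + 1).factorial) := by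
  have hd := h.d_pos
  have hR := h.R_pos
  have htr := h.transform_le hE
  have hconv (x : E) (hx : ‖x‖ < d) := h.le_convolution hE hd5 hx
  have hv0 (z : E) := h.indicator_besselProfile_nonneg z
  have hv : Integrable ((Metric.ball (0 : E) R).indicator fun x ↦ besselProfile n d R ‖x‖) :=
    integrable_ball_indicator (continuous_besselProfile n d R) R
  have hχ : Integrable ((Metric.ball (0 : E) R).indicator fun _ ↦ (1 : ℝ)) :=
    integrable_ball_indicator (f := fun _ ↦ 1) continuous_const R
  have hχ0 (x : E) : 0 ≤ (Metric.ball (0 : E) R).indicator (fun _ ↦ (1 : ℝ)) x :=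
    Set.indicator_nonneg (fun _ _ ↦ zero_le_one) x
  have hχ1 (x : E) : (Metric.ball (0 : E) R).indicator (fun _ ↦ (1 : ℝ)) x ≤ 1 :=
    Set.indicator_le_self' (fun _ _ ↦ zero_le_one) x
  have hχe (x : E) : (Metric.ball (0 : E) R).indicator (fun _ ↦ (1 : ℝ)) (-x) =
      (Metric.ball (0 : E) R).indicator (fun _ ↦ (1 : ℝ)) x := by
    simp [Set.indicator]
  set B := π ^ (n + 1) * R ^ (2 * (n + 1)) / (n + 1).factorial
  have hB : 0 < B := by positivity
  set v := (Metric.ball (0 : E) R).indicator fun x ↦ besselProfile n d R ‖x‖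
  set χ := (Metric.ball (0 : E) R).indicator fun _ ↦ (1 : ℝ)
  set p := (Metric.ball (0 : E) d).indicator fun x ↦ 1 - ‖x‖ ^ 2 / d ^ 2 with hp
  have hp0 (x : E) : 0 ≤ p x := by
    refine Set.indicator_nonneg (fun x hx ↦ ?_) x
    rw [mem_ball_zero_iff] at hx
    rw [sub_nonneg, div_le_one (by positivity)]
    gcongr
  have hp1 (x : E) : p x ≤ 1 := by
    by_cases hx : x ∈ Metric.ball (0 : E) d
    · rw [hp, Set.indicator_of_mem hx, sub_le_self_iff]
      positivity
    · rw [hp, Set.indicator_of_notMem hx]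
      exact zero_le_one
  have hpm : AEStronglyMeasurable p :=
    (integrable_ball_indicator (f := fun r ↦ 1 - r ^ 2 / d ^ 2) (by fun_prop) d).1
  have hpa : Integrable fun x ↦ p x * a x :=
    ha_int.bdd_mul (c := 1) hpm (.of_forall fun x ↦ by
      rw [Real.norm_of_nonneg (hp0 x)]; exact hp1 x)
  set w : E → ℝ := fun x ↦ ∫ z, v z * χ (x - z) with hw
  have hwi : Integrable w := (integrable_mul_comp_sub hv hχ).integral_prod_left
  have hw0 (x : E) : 0 ≤ w x := integral_nonneg fun z ↦ mul_nonneg (hv0 z) (hχ0 _)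
  have hwb (x : E) : w x ≤ ∫ z, v z :=
    integral_mono_of_nonneg (.of_forall fun z ↦ mul_nonneg (hv0 z) (hχ0 _)) hv
      (.of_forall fun z ↦ mul_le_of_le_one_right (hv0 z) (hχ1 _))
  have hwa : Integrable fun x ↦ w x * a x :=
    ha_int.bdd_mul hwi.1 (.of_forall fun x ↦ by
      rw [Real.norm_of_nonneg (hw0 x)]; exact hwb x)
  have hM : 0 < ∫ x, p x * a x := integral_parabola_mul_pos hd ha_cont ha0 ha_nonneg hpa
  have hlower : B * ∫ x, p x * a x ≤ ∫ x, w x * a x := by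
    rw [← integral_const_mul]
    refine integral_mono (hpa.const_mul B) hwa fun x ↦ ?_
    simp only [← mul_assoc]
    refine mul_le_mul_of_nonneg_right ?_ (ha_nonneg x)
    by_cases hx : ‖x‖ < d
    · rw [hp, Set.indicator_of_mem (mem_ball_zero_iff.2 hx)]
      exact hconv x hx
    · rw [hp, Set.indicator_of_notMem (mt mem_ball_zero_iff.1 hx), mul_zero]
      exact hw0 x
  have hupper : ∫ x, w x * a x ≤ K * (B ^ 2 / c * ∫ x, p x * a x) := by
    have hstep : ∫ x, w x * a x =
        K * ∫ y, ((∫ x, cos ⟪y, x⟫ * v x) * ∫ x, cos ⟪y, x⟫ * χ x) * A y := by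
      calc ∫ x, w x * a x = K * ∫ x, w x * ∫ y, cos ⟪x, y⟫ * A y := by
            rw [← integral_const_mul]
            congr 1 with x
            rw [haA]
            ring
        _ = _ := by
            rw [integral_mul_integral_cos hwi hA]
            simp_rw [hw, integral_cos_inner_mul_convolution _ hv hχ hχe]
    rw [hstep, ← integral_const_mul (B ^ 2 / c)]
    refine mul_le_mul_of_nonneg_left ?_ hK
    have hpt (y : E) : ((∫ x, cos ⟪y, x⟫ * v x) * ∫ x, cos ⟪y, x⟫ * χ x) * A y ≤
        B ^ 2 / c * (p y * a y) := by
      have hpA : p y * (c * A y) ≤ p y * a y := by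
        by_cases hy : ‖y‖ < d
        · exact mul_le_mul_of_nonneg_left (hle y hy) (hp0 y)
        · simp [hp, Set.indicator_of_notMem (mt mem_ball_zero_iff.1 hy)]
      calc _ ≤ B ^ 2 * p y * A y := mul_le_mul_of_nonneg_right (htr y) (hA_nonneg y)
        _ = B ^ 2 / c * (p y * (c * A y)) := by field_simp
        _ ≤ _ := by gcongr
    by_cases hint : Integrable fun y ↦ ((∫ x, cos ⟪y, x⟫ * v x) * ∫ x, cos ⟪y, x⟫ * χ x) * A y
    · exact integral_mono hint (hpa.const_mul _) hpt
    · rw [integral_undef hint]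
      exact integral_nonneg fun y ↦ mul_nonneg (by positivity) (mul_nonneg (hp0 y) (ha_nonneg y))
  have hfin := hlower.trans hupper
  have : B * (∫ x, p x * a x) * c ≤ B * (∫ x, p x * a x) * (K * B) := by
    calc _ ≤ K * (B ^ 2 / c * ∫ x, p x * a x) * c := by gcongr
      _ = _ := by field_simp
  exact le_of_mul_le_mul_left this (by positivity)

lemma IsFirstBesselZero.le_of_fourierCos_le {n : ℕ} {d R : ℝ} (h : IsFirstBesselZero n d R)
    (hd5 : d ^ 5 ≤ 6 * n.factorial * -besselE n (R ^ 2 * d ^ 2 / 4) * R) {c : ℝ} (hc : 0 < c)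
    {a : EuclideanSpace ℝ (Fin (2 * (n + 1))) → ℝ} (ha_even : ∀ x, a (-x) = a x)
    (ha_cont : Continuous a) (ha_nonneg : ∀ x, 0 ≤ a x) (ha_int : Integrable a) (ha0 : 0 < a 0)
    (ha_hat_nonneg : ∀ x, 0 ≤ fourierCos (n + 1) a x)
    (h_code : ∀ x, ‖x‖ < d → c * fourierCos (n + 1) a x ≤ a x) :
    c ≤ 1 / (2 * π) ^ (n + 1) * (π ^ (n + 1) * R ^ (2 * (n + 1)) / (n + 1).factorial) := by
  have hE : Module.finrank ℝ (EuclideanSpace ℝ (Fin (2 * (n + 1)))) = 2 * (n + 1) := by simp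
  have : Nontrivial (EuclideanSpace ℝ (Fin (2 * (n + 1)))) :=
    Module.nontrivial_of_finrank_pos (R := ℝ) (by omega)
  obtain ⟨hA, hinv⟩ := fourierCos_inversion ha_cont ha_int ha_even ha_hat_nonneg
  exact h.le_of_cos_transform hE hd5 hc (by positivity) ha_cont ha_nonneg ha_int ha0 hA
    ha_hat_nonneg (fun x ↦ (congrFun hinv x).symm) h_code

lemma mul_succ_le_Gamma_add_half (n : ℕ) :
    8 * ((n : ℝ) + 1) ≤ 9 * √π * Gamma (n + 1 / 2) * 2 ^ n := by
  have hpi := pi_gt_three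
  have hs := mul_self_sqrt pi_nonneg
  rcases n.eq_zero_or_pos with rfl | hn
  · simp only [Nat.cast_zero, zero_add, Gamma_one_half_eq]
    nlinarith
  · induction n, hn using Nat.le_induction with
    | base =>
      rw [Nat.cast_one, add_comm (1 : ℝ) (1 / 2), Gamma_add_one (by norm_num), Gamma_one_half_eq]
      norm_num
      nlinarith
    | succ n hn ih =>
      have hn' : (1 : ℝ) ≤ n := by exact_mod_cast hn
      rw [Nat.cast_succ, show (n : ℝ) + 1 + 1 / 2 = n + 1 / 2 + 1 by ring,
        Gamma_add_one (by positivity), pow_succ]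
      calc 8 * ((n : ℝ) + 1 + 1) ≤ 8 * (n + 1) * (2 * n + 1) := by nlinarith
        _ ≤ (9 * √π * Gamma (n + 1 / 2) * 2 ^ n) * (2 * n + 1) := by gcongr
        _ = _ := by ring

lemma pow_six_le_of_le_rpow {n : ℕ} {j d : ℝ} (hj : 0 < j) (hd : 0 < d)
    (hP : besselE n (j ^ 2 / 4) < 0)
    (hd_plus : d ≤ (16 * ((n + 1).factorial : ℝ) * |besselJ n j| /
      (3 * √π * Gamma ((2 * ((n + 1 : ℕ) : ℝ) - 1) / 2) * j ^ (((n + 1 : ℕ) : ℝ) - 2))) ^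
        ((1 : ℝ) / 6)) :
    d ^ 6 ≤ 6 * n.factorial * -besselE n (j ^ 2 / 4) * j := by
  have hG : 0 < Gamma ((n : ℝ) + 1 / 2) := Gamma_pos_of_pos (by positivity)
  have hpow : j ^ (((n + 1 : ℕ) : ℝ) - 2) = j ^ n / j := by
    rw [show ((n + 1 : ℕ) : ℝ) - 2 = n - 1 by push_cast; ring, rpow_sub_one hj.ne', rpow_natCast]
  rw [show (2 * ((n + 1 : ℕ) : ℝ) - 1) / 2 = n + 1 / 2 by push_cast; ring, hpow, besselJ_eq,
    abs_mul, abs_of_pos (by positivity), abs_of_neg hP] at hd_plus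
  have hkey := mul_succ_le_Gamma_add_half n
  have hp : 0 < -besselE n (j ^ 2 / 4) := neg_pos.2 hP
  generalize -besselE n (j ^ 2 / 4) = p at *
  have h1 := pow_le_pow_left₀ hd.le hd_plus 6
  rw [← rpow_mul_natCast (by positivity)] at h1
  norm_num at h1
  refine h1.trans ?_
  rw [div_le_iff₀ (by positivity), Nat.factorial_succ, div_pow]
  push_cast
  have h2 : 16 * (((n : ℝ) + 1) * n.factorial) * (j ^ n / 2 ^ n * p) =
      2 * (n.factorial * (j ^ n / 2 ^ n) * p) * (8 * ((n : ℝ) + 1)) := by ring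
  rw [h2]
  refine (mul_le_mul_of_nonneg_left hkey (by positivity)).trans_eq ?_
  field_simp
  ring

/-- Analytic core of the quantum Levenshtein bound (Theorem 2): for `N ≥ 1`, `j` the first
positive zero of `J_N`, and `0 < d ≤ d₊`, any even continuous nonnegative integrable
`a : ℝ^{2N} → ℝ` with `a(0) > 0`, `â ≥ 0`, and `c·â(x) ≤ a(x)` for `‖x‖ < d` forces
`c·d^{2N} ≤ j^{2N}/(N!·2^N)`. -/
theorem quantum_levenshtein (N : ℕ) (hN : 1 ≤ N) (j : ℝ) (hj : 0 < j)
    (hjz : besselJ N j = 0) (hj_first : ∀ t : ℝ, 0 < t → t < j → besselJ N t ≠ 0)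
    (d : ℝ) (hd : 0 < d)
    (hd_plus : d ≤ (16 * (N.factorial : ℝ) * |besselJ (N - 1) j| /
      (3 * Real.sqrt π * Real.Gamma ((2 * (N : ℝ) - 1) / 2) * j ^ ((N : ℝ) - 2))) ^ ((1 : ℝ) / 6))
    (c : ℝ) (hc : 0 < c)
    (a : EuclideanSpace ℝ (Fin (2 * N)) → ℝ)
    (ha_even : ∀ x, a (-x) = a x) (ha_cont : Continuous a) (ha_nonneg : ∀ x, 0 ≤ a x)
    (ha_int : Integrable a) (ha0 : 0 < a 0)
    (ha_hat_nonneg : ∀ x, 0 ≤ fourierCos N a x)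
    (h_code : ∀ x, ‖x‖ < d → c * fourierCos N a x ≤ a x) :
    c * d ^ (2 * N) ≤ j ^ (2 * N) / ((N.factorial : ℝ) * 2 ^ N) := by
  obtain ⟨n, rfl⟩ : ∃ n, N = n + 1 := ⟨N - 1, by omega⟩
  have hQ : (j / d) ^ 2 * d ^ 2 / 4 = j ^ 2 / 4 := by field_simp
  have h : IsFirstBesselZero n d (j / d) := by
    refine ⟨hd, by positivity, ?_, ?_⟩
    · rw [besselJ_eq] at hjz
      rw [hQ]
      exact (mul_eq_zero.1 hjz).resolve_left (by positivity)
    · rw [hQ]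
      refine besselE_pos_of_ne_zero fun q hq hqQ hz ↦ hj_first (2 * √q) (by positivity) ?_ ?_
      · refine lt_of_pow_lt_pow_left₀ 2 hj.le ?_
        rw [mul_pow, sq_sqrt hq.le]
        linarith
      · rw [besselJ_eq, mul_pow, sq_sqrt hq.le, show (2 : ℝ) ^ 2 * q / 4 = q by ring, hz, mul_zero]
  have hd5 : d ^ 5 ≤ 6 * n.factorial * -besselE n ((j / d) ^ 2 * d ^ 2 / 4) * (j / d) := by
    have hP := h.besselE_neg
    rw [hQ] at hP ⊢
    rw [← mul_div_assoc, le_div_iff₀ hd]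
    exact pow_six_le_of_le_rpow hj hd hP hd_plus
  have hfin := h.le_of_fourierCos_le hd5 hc ha_even ha_cont ha_nonneg ha_int ha0 ha_hat_nonneg
    h_code
  calc c * d ^ (2 * (n + 1)) ≤ _ * d ^ (2 * (n + 1)) :=
        mul_le_mul_of_nonneg_right hfin (by positivity)
    _ = _ := by
        rw [div_pow, mul_pow]
        field_simp
end

section
/- Quartic upper bound for the zonal spherical function (Appendix D): Let N ≥ 1 be an integer and j the first positive zero of J_N. Then for every x ∈ (0, j], J_{N−1}(x)/x^{N−1} − J_{N−1}(j)/j^{N−1} ≤ (1/(2^N·N!))·((x−j)² + (x−j)³/j + (x−j)⁴/(4j²)). -/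
open Real

/-- The entire function `u ↦ ∑ (-1)^k u^k / (k! (k+ν)!)`, for which
`J_ν(x) = (x/2)^ν * besselEntire ν (x²/4)`. -/
noncomputable def besselEntire (ν : ℕ) (u : ℝ) : ℝ :=
  ∑' k : ℕ, (-1 : ℝ) ^ k / ((k.factorial : ℝ) * ((k + ν).factorial : ℝ)) * u ^ k

lemma besselJ_eq_mul_besselEntire (ν : ℕ) (x : ℝ) :
    besselJ ν x = (x / 2) ^ ν * besselEntire ν (x ^ 2 / 4) := by
  rw [besselJ, besselEntire, ← tsum_mul_left]
  refine tsum_congr fun k => ?_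
  rw [pow_add, pow_mul, show (x / 2) ^ 2 = x ^ 2 / 4 by ring]
  ring

lemma abs_besselEntire_coeff_le (ν k : ℕ) :
    |(-1 : ℝ) ^ k / ((k.factorial : ℝ) * ((k + ν).factorial : ℝ))| ≤ 1 / (k.factorial : ℝ) := by
  rw [abs_div, abs_pow, abs_neg, abs_one, one_pow, abs_of_nonneg (by positivity)]
  have h : (1 : ℝ) ≤ ((k + ν).factorial : ℝ) := by exact_mod_cast Nat.factorial_pos _
  have hk : (0 : ℝ) < (k.factorial : ℝ) := by exact_mod_cast Nat.factorial_pos _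
  exact one_div_le_one_div_of_le hk (le_mul_of_one_le_right hk.le h)

lemma summable_besselEntire (ν : ℕ) (u : ℝ) :
    Summable fun k : ℕ =>
      (-1 : ℝ) ^ k / ((k.factorial : ℝ) * ((k + ν).factorial : ℝ)) * u ^ k := by
  refine Summable.of_norm_bounded (Real.summable_pow_div_factorial |u|) fun k => ?_
  rw [Real.norm_eq_abs, abs_mul, abs_pow]
  calc _ ≤ 1 / (k.factorial : ℝ) * |u| ^ k := by
        gcongr
        exact abs_besselEntire_coeff_le ν k
    _ = _ := by ring

lemma besselEntire_coeff_succ (ν k : ℕ) :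
    (-1 : ℝ) ^ (k + 1) / (((k + 1).factorial : ℝ) * ((k + 1 + ν).factorial : ℝ)) *
        ((k + 1 : ℕ) : ℝ) =
      -((-1 : ℝ) ^ k / ((k.factorial : ℝ) * ((k + (ν + 1)).factorial : ℝ))) := by
  have hk : (k.factorial : ℝ) ≠ 0 := by exact_mod_cast Nat.factorial_ne_zero _
  have hm : ((k + (ν + 1)).factorial : ℝ) ≠ 0 := by exact_mod_cast Nat.factorial_ne_zero _
  have h1 : ((k : ℝ) + 1) ≠ 0 := by positivity
  rw [show k + 1 + ν = k + (ν + 1) by ring, Nat.factorial_succ k]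
  push_cast
  field_simp
  ring

lemma hasDerivAt_besselEntire (ν : ℕ) (u : ℝ) :
    HasDerivAt (besselEntire ν) (-besselEntire (ν + 1) u) u := by
  set R : ℝ := |u| + 1
  have hu : u ∈ Metric.ball (0 : ℝ) R := by
    rw [mem_ball_zero_iff, Real.norm_eq_abs]
    exact lt_add_one _
  have hbound : Summable fun k : ℕ => 1 / (k.factorial : ℝ) * (k * R ^ (k - 1)) := by
    rw [← summable_nat_add_iff 1]
    refine (Real.summable_pow_div_factorial R).congr fun k => ?_
    have h1 : ((k : ℝ) + 1) ≠ 0 := by positivity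
    rw [Nat.factorial_succ, Nat.add_sub_cancel]
    push_cast
    field_simp
  have hle : ∀ (k : ℕ) (y : ℝ), y ∈ Metric.ball (0 : ℝ) R →
      ‖(-1 : ℝ) ^ k / ((k.factorial : ℝ) * ((k + ν).factorial : ℝ)) * (k * y ^ (k - 1))‖ ≤
        1 / (k.factorial : ℝ) * (k * R ^ (k - 1)) := by
    intro k y hy
    rw [mem_ball_zero_iff, Real.norm_eq_abs] at hy
    rw [Real.norm_eq_abs, abs_mul, abs_mul, abs_pow, Nat.abs_cast]
    gcongr
    exact abs_besselEntire_coeff_le ν k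
  have key := hasDerivAt_tsum_of_isPreconnected hbound Metric.isOpen_ball
    (convex_ball (0 : ℝ) R).isPreconnected
    (fun k y _ => (hasDerivAt_pow k y).const_mul
      ((-1 : ℝ) ^ k / ((k.factorial : ℝ) * ((k + ν).factorial : ℝ))))
    hle hu (summable_besselEntire ν u) hu
  refine key.congr_deriv ?_
  rw [(Summable.of_norm_bounded hbound fun k => hle k u hu).tsum_eq_zero_add, besselEntire,
    ← tsum_neg]
  simp only [Nat.cast_zero, zero_mul, mul_zero, zero_add]
  refine tsum_congr fun k => ?_
  rw [← mul_assoc, besselEntire_coeff_succ, Nat.add_sub_cancel, neg_mul]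

lemma continuous_besselEntire (ν : ℕ) : Continuous (besselEntire ν) :=
  continuous_iff_continuousAt.2 fun u => (hasDerivAt_besselEntire ν u).continuousAt

lemma besselEntire_zero (ν : ℕ) : besselEntire ν 0 = 1 / (ν.factorial : ℝ) := by
  rw [besselEntire, tsum_eq_single 0 fun k hk => by simp [hk]]
  simp

lemma besselEntire_recurrence (ν : ℕ) (u : ℝ) :
    (ν + 1) * besselEntire (ν + 1) u - u * besselEntire (ν + 2) u = besselEntire ν u := by
  have hlast : -(u * besselEntire (ν + 2) u) =
      ∑' k : ℕ, (-1 : ℝ) ^ k / ((k.factorial : ℝ) * ((k + (ν + 1)).factorial : ℝ)) * k * u ^ k ∧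
      Summable fun k : ℕ =>
        (-1 : ℝ) ^ k / ((k.factorial : ℝ) * ((k + (ν + 1)).factorial : ℝ)) * k * u ^ k := by
    have hs : Summable fun k : ℕ =>
        (-1 : ℝ) ^ k / ((k.factorial : ℝ) * ((k + (ν + 1)).factorial : ℝ)) * k * u ^ k := by
      rw [← summable_nat_add_iff 1]
      refine ((summable_besselEntire (ν + 2) u).mul_left (-u)).congr fun k => ?_
      rw [besselEntire_coeff_succ]
      ring
    refine ⟨?_, hs⟩
    rw [hs.tsum_eq_zero_add, besselEntire, ← tsum_mul_left, ← tsum_neg]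
    simp only [Nat.cast_zero, zero_mul, mul_zero, zero_add]
    refine tsum_congr fun k => ?_
    rw [besselEntire_coeff_succ]
    ring
  rw [sub_eq_add_neg, hlast.1, besselEntire, ← tsum_mul_left,
    ← ((summable_besselEntire (ν + 1) u).mul_left _).tsum_add hlast.2, besselEntire]
  refine tsum_congr fun k => ?_
  have hk : (k.factorial : ℝ) ≠ 0 := by exact_mod_cast Nat.factorial_ne_zero _
  have hm : ((k + ν).factorial : ℝ) ≠ 0 := by exact_mod_cast Nat.factorial_ne_zero _
  have h1 : ((k : ℝ) + ν + 1) ≠ 0 := by positivity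
  rw [← add_assoc k ν 1, Nat.factorial_succ]
  push_cast
  field_simp
  ring

lemma hasDerivAt_pow_mul_besselEntire (ν : ℕ) (u : ℝ) :
    HasDerivAt (fun v => v ^ (ν + 1) * besselEntire (ν + 1) v) (u ^ ν * besselEntire ν u) u := by
  refine ((hasDerivAt_pow (ν + 1) u).mul (hasDerivAt_besselEntire (ν + 1) u)).congr_deriv ?_
  rw [← besselEntire_recurrence ν u, Nat.add_sub_cancel]
  push_cast
  ring

lemma besselEntire_succ_nonneg {ν : ℕ} {a : ℝ}
    (h : ∀ u ∈ Set.Icc 0 a, 0 ≤ besselEntire ν u) :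
    ∀ u ∈ Set.Icc 0 a, 0 ≤ besselEntire (ν + 1) u := by
  intro u hu
  rcases hu.1.eq_or_lt with rfl | hpos
  · rw [besselEntire_zero]
    positivity
  have hmono : MonotoneOn (fun v => v ^ (ν + 1) * besselEntire (ν + 1) v) (Set.Icc 0 a) := by
    refine monotoneOn_of_hasDerivWithinAt_nonneg (convex_Icc 0 a)
      (fun v _ => (hasDerivAt_pow_mul_besselEntire ν v).continuousAt.continuousWithinAt)
      (fun v _ => (hasDerivAt_pow_mul_besselEntire ν v).hasDerivWithinAt) fun v hv => ?_
    have hv' := interior_subset hv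
    exact mul_nonneg (pow_nonneg hv'.1 _) (h v hv')
  have h0 := hmono ⟨le_rfl, hu.1.trans hu.2⟩ hu hu.1
  simp only [ne_eq, Nat.succ_ne_zero, not_false_eq_true, zero_pow, zero_mul] at h0
  exact nonneg_of_mul_nonneg_right h0 (pow_pos hpos _)

lemma besselEntire_nonneg_of_first_zero {ν : ℕ} {a : ℝ} (hz : besselEntire ν a = 0)
    (hfirst : ∀ u, 0 < u → u < a → besselEntire ν u ≠ 0) :
    ∀ u ∈ Set.Icc 0 a, 0 ≤ besselEntire ν u := by
  intro u hu
  by_contra! hneg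
  have h0 : 0 < besselEntire ν 0 := by
    rw [besselEntire_zero]
    positivity
  obtain ⟨v, hv, hv0⟩ :=
    intermediate_value_Icc' hu.1 (continuous_besselEntire ν).continuousOn ⟨hneg.le, h0.le⟩
  have hv_pos : 0 < v := hv.1.lt_of_ne' fun h => by
    rw [h] at hv0
    exact h0.ne' hv0
  have hva : v ≠ a := by
    rintro rfl
    rw [le_antisymm hu.2 hv.2, hz] at hneg
    exact hneg.false
  exact hfirst v hv_pos ((hv.2.trans hu.2).lt_of_ne hva) hv0

lemma convexOn_besselEntire {ν : ℕ} {a : ℝ} (h : ∀ u ∈ Set.Icc 0 a, 0 ≤ besselEntire ν u) :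
    ConvexOn ℝ (Set.Icc 0 a) (besselEntire ν) := by
  refine convexOn_of_hasDerivWithinAt2_nonneg (convex_Icc 0 a)
    (continuous_besselEntire ν).continuousOn
    (fun u _ => (hasDerivAt_besselEntire ν u).hasDerivWithinAt)
    (fun u _ => (hasDerivAt_besselEntire (ν + 1) u).neg.hasDerivWithinAt) fun u hu => ?_
  rw [neg_neg]
  exact besselEntire_succ_nonneg (besselEntire_succ_nonneg h) u (interior_subset hu)

lemma besselEntire_le_chord {ν : ℕ} {a : ℝ} (ha : 0 < a) (hz : besselEntire ν a = 0)
    (hfirst : ∀ u, 0 < u → u < a → besselEntire ν u ≠ 0) {u : ℝ} (hu : u ∈ Set.Icc 0 a) :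
    besselEntire ν u ≤ 1 / (ν.factorial : ℝ) * (1 - u / a) := by
  have hconv := (convexOn_besselEntire (besselEntire_nonneg_of_first_zero hz hfirst)).2
    (Set.left_mem_Icc.2 ha.le) (Set.right_mem_Icc.2 ha.le)
    (sub_nonneg.2 ((div_le_one ha).2 hu.2)) (div_nonneg hu.1 ha.le) (sub_add_cancel 1 (u / a))
  simp only [smul_eq_mul, mul_zero, zero_add, hz, add_zero, div_mul_cancel₀ u ha.ne',
    besselEntire_zero] at hconv
  linarith

lemma besselEntire_sub_le {ν : ℕ} {a : ℝ} (ha : 0 < a) (hz : besselEntire (ν + 1) a = 0)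
    (hfirst : ∀ u, 0 < u → u < a → besselEntire (ν + 1) u ≠ 0) {u : ℝ}
    (hu : u ∈ Set.Icc 0 a) :
    besselEntire ν u - besselEntire ν a ≤
      1 / ((ν + 1).factorial : ℝ) * ((a - u) ^ 2 / (2 * a)) := by
  have hderiv : ∀ v : ℝ, HasDerivAt
      (fun v => 1 / ((ν + 1).factorial : ℝ) * ((a - v) ^ 2 / (2 * a)) - besselEntire ν v)
      (besselEntire (ν + 1) v - 1 / ((ν + 1).factorial : ℝ) * (1 - v / a)) v := by
    intro v
    refine (((((((hasDerivAt_id v).const_sub a).pow 2).div_const (2 * a)).const_mul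
      (1 / ((ν + 1).factorial : ℝ))).sub (hasDerivAt_besselEntire ν v))).congr_deriv ?_
    simp only [id]
    field_simp
    ring
  have hanti : AntitoneOn
      (fun v => 1 / ((ν + 1).factorial : ℝ) * ((a - v) ^ 2 / (2 * a)) - besselEntire ν v)
      (Set.Icc 0 a) :=
    antitoneOn_of_hasDerivWithinAt_nonpos (convex_Icc 0 a)
      (fun v _ => (hderiv v).continuousAt.continuousWithinAt)
      (fun v _ => (hderiv v).hasDerivWithinAt)
      fun v hv => sub_nonpos.2 (besselEntire_le_chord ha hz hfirst (interior_subset hv))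
  have hend := hanti hu (Set.right_mem_Icc.2 ha.le) hu.2
  simp only [sub_self, ne_eq, OfNat.ofNat_ne_zero, not_false_eq_true, zero_pow, zero_div,
    mul_zero, zero_sub] at hend
  linarith

/-- Quartic upper bound for the zonal spherical function (Appendix D): for `N ≥ 1`,
`j` the first positive zero of `J_N`, and `x ∈ (0, j]`,
`J_{N−1}(x)/x^{N−1} − J_{N−1}(j)/j^{N−1} ≤ (1/(2^N·N!))·((x−j)² + (x−j)³/j + (x−j)⁴/(4j²))`. -/
theorem zonal_quartic_bound (N : ℕ) (hN : 1 ≤ N) (j : ℝ) (hj : 0 < j)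
    (hjz : besselJ N j = 0) (hj_first : ∀ t : ℝ, 0 < t → t < j → besselJ N t ≠ 0)
    (x : ℝ) (hx : 0 < x) (hxj : x ≤ j) :
    besselJ (N - 1) x / x ^ (N - 1) - besselJ (N - 1) j / j ^ (N - 1) ≤
      1 / (2 ^ N * (N.factorial : ℝ)) *
        ((x - j) ^ 2 + (x - j) ^ 3 / j + (x - j) ^ 4 / (4 * j ^ 2)) := by
  obtain ⟨ν, rfl⟩ := Nat.exists_eq_add_of_le' hN
  rw [Nat.add_sub_cancel]
  have hzero : besselEntire (ν + 1) (j ^ 2 / 4) = 0 := by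
    rw [besselJ_eq_mul_besselEntire] at hjz
    exact (mul_eq_zero.1 hjz).resolve_left (by positivity)
  have hfirst : ∀ u, 0 < u → u < j ^ 2 / 4 → besselEntire (ν + 1) u ≠ 0 := by
    intro u hu huj h
    refine hj_first (2 * √u) (by positivity) ?_ ?_
    · have : √u < j / 2 := (Real.sqrt_lt' (by positivity)).2 (by linarith [div_pow j 2 2])
      linarith
    · rw [besselJ_eq_mul_besselEntire, mul_pow, Real.sq_sqrt hu.le,
        show (2 : ℝ) ^ 2 * u / 4 = u by ring, h, mul_zero]
  have hscale : ∀ y : ℝ, 0 < y →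
      besselJ ν y / y ^ ν = besselEntire ν (y ^ 2 / 4) / 2 ^ ν := by
    intro y hy
    rw [besselJ_eq_mul_besselEntire, div_pow]
    field_simp
  have hle := besselEntire_sub_le (by positivity) hzero hfirst
    (u := x ^ 2 / 4) ⟨by positivity, by gcongr⟩
  rw [hscale x hx, hscale j hj, ← sub_div]
  calc _ ≤ 1 / ((ν + 1).factorial : ℝ) *
          ((j ^ 2 / 4 - x ^ 2 / 4) ^ 2 / (2 * (j ^ 2 / 4))) / 2 ^ ν := by gcongr
    _ = _ := by
      rw [pow_succ (2 : ℝ) ν]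
      field_simp
      ring
end

section
/- Quadratic upper bound for the zonal spherical function (Appendix D): Let N ≥ 1 be an integer and j the first positive zero of J_N. Then for every x ∈ (0, j], J_{N−1}(x)/x^{N−1} − J_{N−1}(j)/j^{N−1} ≤ (9/(2^{N+2}·N!))·(x−j)². -/
open Real

/-- The entire function `∑ (-s)^k / (k! (k+ν)!)`, related to the Bessel function by
`J_ν(x) = (x/2)^ν F_ν(x²/4)`. -/
noncomputable def besselClifford (ν : ℕ) (s : ℝ) : ℝ :=
  ∑' k : ℕ, (-s) ^ k / ((k.factorial : ℝ) * ((k + ν).factorial : ℝ))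

theorem summable_besselClifford (ν : ℕ) (s : ℝ) :
    Summable fun k : ℕ => (-s) ^ k / ((k.factorial : ℝ) * ((k + ν).factorial : ℝ)) := by
  refine Summable.of_norm_bounded (Real.summable_pow_div_factorial |s|) fun k => ?_
  have h1 : (1 : ℝ) ≤ ((k + ν).factorial : ℝ) := by exact_mod_cast (k + ν).factorial_pos
  have h2 : (0 : ℝ) < (k.factorial : ℝ) := by exact_mod_cast k.factorial_pos
  rw [norm_div, norm_pow, norm_neg, Real.norm_eq_abs, Real.norm_of_nonneg (by positivity)]
  gcongr
  exact le_mul_of_one_le_right h2.le h1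

theorem besselJ_eq_besselClifford (ν : ℕ) (x : ℝ) :
    besselJ ν x = (x / 2) ^ ν * besselClifford ν (x ^ 2 / 4) := by
  rw [besselJ, besselClifford, ← tsum_mul_left]
  refine tsum_congr fun k => ?_
  have : (-(x ^ 2 / 4)) ^ k = (-1) ^ k * (x / 2) ^ (2 * k) := by
    rw [pow_mul, ← mul_pow]; congr 1; ring
  rw [this, pow_add]
  ring

theorem besselClifford_zero (ν : ℕ) : besselClifford ν 0 = 1 / (ν.factorial : ℝ) := by
  rw [besselClifford, tsum_eq_single 0 (fun k hk => by simp [hk])]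
  simp

theorem hasDerivAt_besselClifford (ν : ℕ) (s : ℝ) :
    HasDerivAt (besselClifford ν) (-besselClifford (ν + 1) s) s := by
  set R : ℝ := |s| + 1 with hR
  have hR0 : 0 ≤ R := by positivity
  have hu : Summable fun k : ℕ => (k : ℝ) * R ^ (k - 1) / (k.factorial : ℝ) := by
    rw [← summable_nat_add_iff 1]
    refine (Real.summable_pow_div_factorial R).congr fun k => ?_
    rw [Nat.factorial_succ, Nat.add_sub_cancel]
    push_cast
    field_simp
  have key := hasDerivAt_tsum_of_isPreconnected
    (g := fun (k : ℕ) (y : ℝ) => (-y) ^ k / ((k.factorial : ℝ) * ((k + ν).factorial : ℝ)))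
    (g' := fun (k : ℕ) (y : ℝ) =>
      (k : ℝ) * (-y) ^ (k - 1) * (-1) / ((k.factorial : ℝ) * ((k + ν).factorial : ℝ)))
    (t := Metric.ball (0 : ℝ) R) (y₀ := s) (y := s) hu Metric.isOpen_ball
    (convex_ball _ _).isPreconnected
    (fun k y _ => ((hasDerivAt_neg y).pow k).div_const _)
    (fun k y hy => by
      have h1 : (1 : ℝ) ≤ ((k + ν).factorial : ℝ) := by exact_mod_cast (k + ν).factorial_pos
      have h2 : (0 : ℝ) < (k.factorial : ℝ) := by exact_mod_cast k.factorial_pos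
      have hy' : |y| ≤ R := by simpa using (mem_ball_zero_iff.mp hy).le
      rw [norm_div, norm_mul, norm_mul, norm_pow, norm_neg, norm_neg, norm_one, mul_one,
        Real.norm_eq_abs y, Real.norm_of_nonneg (Nat.cast_nonneg k),
        Real.norm_of_nonneg (by positivity)]
      gcongr
      exact le_mul_of_one_le_right h2.le h1)
    (by simp [hR]) (summable_besselClifford ν s) (by simp [hR])
  have hval : (∑' k : ℕ, (k : ℝ) * (-s) ^ (k - 1) * (-1) /
      ((k.factorial : ℝ) * ((k + ν).factorial : ℝ))) = -besselClifford (ν + 1) s := by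
    have hterm : ∀ k : ℕ, ((k + 1 : ℕ) : ℝ) * (-s) ^ (k + 1 - 1) * (-1) /
        (((k + 1).factorial : ℝ) * ((k + 1 + ν).factorial : ℝ)) =
        -((-s) ^ k / ((k.factorial : ℝ) * ((k + (ν + 1)).factorial : ℝ))) := fun k => by
      rw [Nat.factorial_succ k, Nat.add_sub_cancel, show k + 1 + ν = k + (ν + 1) by ring]
      push_cast
      field_simp
    rw [tsum_eq_zero_add' ((summable_besselClifford (ν + 1) s).neg.congr fun k => (hterm k).symm),
      tsum_congr hterm, tsum_neg, besselClifford]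
    simp
  rwa [hval] at key

theorem besselClifford_recurrence (ν : ℕ) (s : ℝ) :
    besselClifford ν s = (ν + 1) * besselClifford (ν + 1) s - s * besselClifford (ν + 2) s := by
  have hterm : ∀ k : ℕ, (ν + 1) * ((-s) ^ (k + 1) /
      (((k + 1).factorial : ℝ) * ((k + 1 + (ν + 1)).factorial : ℝ))) -
      (-s) ^ (k + 1) / (((k + 1).factorial : ℝ) * ((k + 1 + ν).factorial : ℝ)) =
      s * ((-s) ^ k / ((k.factorial : ℝ) * ((k + (ν + 2)).factorial : ℝ))) := fun k => by
    rw [show k + 1 + (ν + 1) = (k + 1 + ν) + 1 by ring, show k + (ν + 2) = (k + 1 + ν) + 1 by ring,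
      Nat.factorial_succ (k + 1 + ν), Nat.factorial_succ k]
    push_cast
    field_simp
    ring
  have hsum := ((summable_besselClifford (ν + 1) s).mul_left ((ν : ℝ) + 1)).sub
    (summable_besselClifford ν s)
  have h : (ν + 1) * besselClifford (ν + 1) s - besselClifford ν s =
      s * besselClifford (ν + 2) s := by
    simp only [besselClifford]
    rw [← tsum_mul_left, ← tsum_mul_left,
      ← ((summable_besselClifford (ν + 1) s).mul_left _).tsum_sub (summable_besselClifford ν s),
      hsum.tsum_eq_zero_add, tsum_congr hterm, add_eq_right, zero_add, zero_add,
      Nat.factorial_succ]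
    push_cast
    field_simp
    ring
  linarith

theorem continuous_besselClifford (ν : ℕ) : Continuous (besselClifford ν) :=
  continuous_iff_continuousAt.mpr fun s => (hasDerivAt_besselClifford ν s).continuousAt

theorem hasDerivAt_pow_mul_besselClifford (ν : ℕ) (s : ℝ) :
    HasDerivAt (fun u => u ^ (ν + 1) * besselClifford (ν + 1) u) (s ^ ν * besselClifford ν s) s := by
  refine ((hasDerivAt_pow (ν + 1) s).mul
    (hasDerivAt_besselClifford (ν + 1) s)).congr_deriv ?_
  rw [besselClifford_recurrence ν s, Nat.add_sub_cancel]
  push_cast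
  ring

/-- Positivity on an initial interval passes to the next order. -/
theorem besselClifford_succ_pos {ν : ℕ} {a : ℝ}
    (h : ∀ s, 0 ≤ s → s < a → 0 < besselClifford ν s) {s : ℝ} (hs : 0 ≤ s) (hsa : s < a) :
    0 < besselClifford (ν + 1) s := by
  rcases hs.eq_or_lt with rfl | hs0
  · rw [besselClifford_zero]
    positivity
  have hmono : StrictMonoOn (fun u => u ^ (ν + 1) * besselClifford (ν + 1) u) (Set.Icc 0 s) := by
    refine strictMonoOn_of_deriv_pos (convex_Icc 0 s)
      ((continuous_pow _).mul (continuous_besselClifford _)).continuousOn fun u hu => ?_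
    rw [interior_Icc] at hu
    rw [(hasDerivAt_pow_mul_besselClifford ν u).deriv]
    exact mul_pos (pow_pos hu.1 _) (h u hu.1.le (hu.2.trans hsa))
  have := hmono (Set.left_mem_Icc.mpr hs) (Set.right_mem_Icc.mpr hs) hs0
  simp only [ne_eq, Nat.add_eq_zero_iff, one_ne_zero, and_false, not_false_eq_true, zero_pow,
    zero_mul] at this
  exact pos_of_mul_pos_right this (by positivity)

theorem besselClifford_pos_of_ne_zero {ν : ℕ} {a : ℝ}
    (h : ∀ s, 0 < s → s < a → besselClifford ν s ≠ 0) {s : ℝ} (hs : 0 ≤ s) (hsa : s < a) :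
    0 < besselClifford ν s := by
  have h0 : 0 < besselClifford ν 0 := by
    rw [besselClifford_zero]
    positivity
  by_contra! hneg
  obtain ⟨u, hu, hu0⟩ := intermediate_value_Icc' hs
    (continuous_besselClifford ν).continuousOn ⟨hneg, h0.le⟩
  rcases hu.1.eq_or_lt with rfl | hpos
  · exact h0.ne' hu0
  · exact h u hpos (hu.2.trans_lt hsa) hu0

theorem convexOn_besselClifford {ν : ℕ} {a : ℝ}
    (h : ∀ s, 0 ≤ s → s < a → 0 < besselClifford ν s) :
    ConvexOn ℝ (Set.Icc 0 a) (besselClifford ν) := by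
  have hderiv : ∀ μ, deriv (besselClifford μ) = fun s => -besselClifford (μ + 1) s := fun μ =>
    funext fun s => (hasDerivAt_besselClifford μ s).deriv
  refine convexOn_of_deriv2_nonneg (convex_Icc 0 a) (continuous_besselClifford ν).continuousOn
    (fun s _ => (hasDerivAt_besselClifford ν s).differentiableAt.differentiableWithinAt) ?_ ?_
  · rw [hderiv]
    exact fun s _ =>
      (hasDerivAt_besselClifford (ν + 1) s).neg.differentiableAt.differentiableWithinAt
  · intro s hs
    rw [interior_Icc] at hs
    rw [Function.iterate_succ_apply, Function.iterate_one, hderiv,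
      (hasDerivAt_besselClifford (ν + 1) s).fun_neg.deriv, neg_neg]
    exact (besselClifford_succ_pos (fun u hu hua => besselClifford_succ_pos h hu hua)
      hs.1.le hs.2).le

/-- Below its first zero `a`, the function lies under the chord from `0` to `a`. -/
theorem besselClifford_le_chord {ν : ℕ} {a : ℝ} (ha : 0 < a) (hz : besselClifford ν a = 0)
    (h : ∀ s, 0 ≤ s → s < a → 0 < besselClifford ν s) {s : ℝ} (hs : 0 ≤ s) (hsa : s ≤ a) :
    besselClifford ν s ≤ (a - s) / (a * ν.factorial) := by
  have := (convexOn_besselClifford h).2 (Set.left_mem_Icc.mpr ha.le) (Set.right_mem_Icc.mpr ha.le)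
    (div_nonneg (sub_nonneg.mpr hsa) ha.le) (div_nonneg hs ha.le) (by field_simp; ring)
  rw [hz, besselClifford_zero] at this
  simp only [smul_eq_mul, mul_zero, zero_add, add_zero, div_mul_cancel₀ _ ha.ne'] at this
  calc _ ≤ _ := this
    _ = _ := by field_simp

theorem besselClifford_sub_le {ν : ℕ} {a : ℝ} (ha : 0 < a) (hz : besselClifford (ν + 1) a = 0)
    (h : ∀ s, 0 ≤ s → s < a → 0 < besselClifford (ν + 1) s) {s : ℝ} (hs : 0 ≤ s) (hsa : s ≤ a) :
    besselClifford ν s - besselClifford ν a ≤ (a - s) ^ 2 / (2 * a * (ν + 1).factorial) := by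
  have hd : ∀ u, HasDerivAt (fun u => besselClifford ν u - (a - u) ^ 2 / (2 * a * (ν + 1).factorial))
      ((a - u) / (a * (ν + 1).factorial) - besselClifford (ν + 1) u) u := fun u => by
    refine ((hasDerivAt_besselClifford ν u).sub
      ((((hasDerivAt_id u).const_sub a).pow 2).div_const
        (2 * a * (ν + 1).factorial))).congr_deriv ?_
    simp only [id_eq]
    push_cast
    field_simp
    ring
  have hmono : MonotoneOn
      (fun u => besselClifford ν u - (a - u) ^ 2 / (2 * a * (ν + 1).factorial)) (Set.Icc 0 a) := by
    refine monotoneOn_of_deriv_nonneg (convex_Icc 0 a)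
      (fun u _ => (hd u).continuousAt.continuousWithinAt)
      (fun u _ => (hd u).differentiableAt.differentiableWithinAt) fun u hu => ?_
    rw [interior_Icc] at hu
    rw [(hd u).deriv, sub_nonneg]
    exact besselClifford_le_chord ha hz h hu.1.le hu.2.le
  have := hmono ⟨hs, hsa⟩ (Set.right_mem_Icc.mpr ha.le) hsa
  simp only [sub_self, ne_eq, OfNat.ofNat_ne_zero, not_false_eq_true, zero_pow, zero_div,
    sub_zero] at this
  linarith

theorem besselJ_div_pow (ν : ℕ) {x : ℝ} (hx : x ≠ 0) :
    besselJ ν x / x ^ ν = besselClifford ν (x ^ 2 / 4) / 2 ^ ν := by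
  rw [besselJ_eq_besselClifford, div_pow]
  field_simp

/-- Quadratic upper bound for the zonal spherical function (Appendix D): for `N ≥ 1`,
`j` the first positive zero of `J_N`, and `x ∈ (0, j]`,
`J_{N−1}(x)/x^{N−1} − J_{N−1}(j)/j^{N−1} ≤ (9/(2^{N+2}·N!))·(x−j)²`. -/
theorem zonal_quadratic_bound (N : ℕ) (hN : 1 ≤ N) (j : ℝ) (hj : 0 < j)
    (hjz : besselJ N j = 0) (hj_first : ∀ t : ℝ, 0 < t → t < j → besselJ N t ≠ 0)
    (x : ℝ) (hx : 0 < x) (hxj : x ≤ j) :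
    besselJ (N - 1) x / x ^ (N - 1) - besselJ (N - 1) j / j ^ (N - 1) ≤
      9 / (2 ^ (N + 2) * (N.factorial : ℝ)) * (x - j) ^ 2 := by
  obtain ⟨ν, rfl⟩ := Nat.exists_eq_add_of_le' hN
  rw [Nat.add_sub_cancel, besselJ_div_pow ν hx.ne', besselJ_div_pow ν hj.ne']
  have hz : besselClifford (ν + 1) (j ^ 2 / 4) = 0 := by
    rw [besselJ_eq_besselClifford] at hjz
    exact (mul_eq_zero.mp hjz).resolve_left (by positivity)
  have hne : ∀ s, 0 < s → s < j ^ 2 / 4 → besselClifford (ν + 1) s ≠ 0 := fun s hs hsj h0 => by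
    have hsq : (2 * √s) ^ 2 = 4 * s := by rw [mul_pow, Real.sq_sqrt hs.le]; norm_num
    refine hj_first (2 * √s) (by positivity) (lt_of_pow_lt_pow_left₀ 2 hj.le (by linarith)) ?_
    rw [besselJ_eq_besselClifford, hsq, mul_div_cancel_left₀ s (by norm_num), h0, mul_zero]
  have hbound := besselClifford_sub_le (by positivity) hz
    (fun s hs hsa => besselClifford_pos_of_ne_zero hne hs hsa) (s := x ^ 2 / 4) (by positivity)
    (by gcongr)
  have hquad : (j ^ 2 / 4 - x ^ 2 / 4) ^ 2 / (2 * (j ^ 2 / 4) * (ν + 1).factorial) ≤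
      9 / (8 * (ν + 1).factorial) * (x - j) ^ 2 := by
    have hsum : (j + x) ^ 2 ≤ 9 * j ^ 2 := by nlinarith
    rw [div_mul_eq_mul_div, div_le_div_iff₀ (by positivity) (by positivity)]
    have := mul_le_mul_of_nonneg_left hsum
      (by positivity : 0 ≤ (x - j) ^ 2 * ((ν + 1).factorial : ℝ) / 2)
    nlinarith [mul_nonneg (by positivity : 0 ≤ (x - j) ^ 2 * ((ν + 1).factorial : ℝ)) (sq_nonneg j)]
  rw [← sub_div, div_le_iff₀ (by positivity)]
  calc _ ≤ _ := hbound.trans hquad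
    _ = _ := by
      field_simp
      ring
end

section
/- Fock-state MacWilliams identity (Laguerre–Hankel eigenfunction identity): For every natural number n and every real r ≥ 0, ∫_0^∞ J_0(r·x)·x·L_n(x²/2)²·e^{−x²/2} dx = L_n(r²/2)²·e^{−r²/2}; that is, the function x ↦ 2πx·L_n(x²/2)²·e^{−x²/2}, which is the weight distribution of the n-th Fock state, is a fixed point of the single-mode Bessel integral kernel B(r) = r·∫_0^∞ J_0(rx)·A(x) dx. -/
open Real MeasureTheory

/-- The Bessel function of the first kind of order 0, defined by its
everywhere-convergent power series. -/
noncomputable def besselJ0 (x : ℝ) : ℝ :=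
  ∑' k : ℕ, (-1 : ℝ) ^ k / ((k.factorial : ℝ)) ^ 2 * (x / 2) ^ (2 * k)

/-- The `n`-th Laguerre polynomial `L_n(x) = ∑_{k=0}^n (n choose k)·(−x)^k/k!`. -/
noncomputable def laguerre (n : ℕ) (x : ℝ) : ℝ :=
  ∑ k ∈ Finset.range (n + 1), (n.choose k : ℝ) * (-x) ^ k / (k.factorial : ℝ)

/-- The linear functional on real polynomials sending `X ^ m` to `t ^ m / m!`
(the Borel transform evaluated at `t`). -/
noncomputable def borelEval (t : ℝ) : Polynomial ℝ →ₗ[ℝ] ℝ :=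
  Polynomial.lsum fun m => (t ^ m / (m.factorial : ℝ)) • LinearMap.id

theorem borelEval_monomial (t : ℝ) (m : ℕ) (a : ℝ) :
    borelEval t (Polynomial.monomial m a) = t ^ m / (m.factorial : ℝ) * a := by
  simp [borelEval, Polynomial.sum_monomial_index]

theorem borelEval_C_mul_X_pow (t : ℝ) (m : ℕ) (a : ℝ) :
    borelEval t (Polynomial.C a * Polynomial.X ^ m) = t ^ m / (m.factorial : ℝ) * a := by
  rw [Polynomial.C_mul_X_pow_eq_monomial, borelEval_monomial]

theorem borelEval_one_sub_X_pow (t : ℝ) (m : ℕ) :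
    borelEval t ((1 - Polynomial.X) ^ m) = laguerre m t := by
  have h : (1 - Polynomial.X : Polynomial ℝ) ^ m =
      ∑ k ∈ Finset.range (m + 1),
        Polynomial.C ((m.choose k : ℝ) * (-1) ^ k) * Polynomial.X ^ k := by
    rw [sub_eq_neg_add, add_pow]
    refine Finset.sum_congr rfl fun k _ => ?_
    rw [neg_pow (Polynomial.X : Polynomial ℝ) k]
    simp
    ring
  rw [h, map_sum, laguerre]
  refine Finset.sum_congr rfl fun k _ => ?_
  rw [borelEval_C_mul_X_pow, neg_pow t k]
  ring

/-- A symmetric form of Vandermonde's identity. -/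
theorem add_choose_eq_sum_choose_mul_choose {n i : ℕ} (hi : i ≤ n) (j : ℕ) :
    (i + j).choose i = ∑ l ∈ Finset.range (n + 1), i.choose l * j.choose l := by
  rw [Nat.add_choose_eq, Finset.Nat.sum_antidiagonal_eq_sum_range_succ_mk,
    ← Finset.sum_range_reflect]
  refine (Finset.sum_congr rfl fun l hl => ?_).trans
    (Finset.sum_subset (s₁ := Finset.range (i + 1)) (by simpa using hi) fun l _ hl => ?_)
  · have hl' : l ≤ i := by simpa [Nat.lt_succ_iff] using hl
    have h₁ : i + 1 - 1 - l = i - l := by omega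
    have h₂ : i - (i - l) = l := by omega
    simp only [h₁, h₂, Nat.choose_symm hl']
  · rw [Nat.choose_eq_zero_of_lt (by simpa using hl), zero_mul]

theorem sum_choose_mul_choose_mul_pow {R : Type*} [CommRing R] {n l : ℕ} (hl : l ≤ n) (y : R) :
    ∑ i ∈ Finset.range (n + 1), (n.choose i * i.choose l : R) * y ^ i =
      n.choose l * y ^ l * (1 + y) ^ (n - l) := by
  obtain ⟨d, rfl⟩ := Nat.exists_eq_add_of_le hl
  rw [add_assoc, Finset.sum_range_add, Finset.sum_eq_zero, zero_add, add_comm 1 y, add_pow,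
    Finset.mul_sum, Nat.add_sub_cancel_left]
  · refine Finset.sum_congr rfl fun k _ => ?_
    have h := Nat.choose_mul (n := l + d) (k := l + k) (s := l) (Nat.le_add_right l k)
    rw [Nat.add_sub_cancel_left, Nat.add_sub_cancel_left] at h
    rw [← Nat.cast_mul, h, pow_add]
    push_cast
    ring
  · intro i hi
    rw [Nat.choose_eq_zero_of_lt (k := l) (by simpa using hi)]
    simp

/-- The polynomial whose Borel transform is the square of the `n`-th Laguerre polynomial. -/
noncomputable def laguerreSqBorel (n : ℕ) : Polynomial ℝ :=
  ∑ l ∈ Finset.range (n + 1),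
    ((n.choose l : Polynomial ℝ) * (-Polynomial.X) ^ l * (1 + -Polynomial.X) ^ (n - l)) ^ 2

theorem laguerreSqBorel_comp_one_sub_X (n : ℕ) :
    (laguerreSqBorel n).comp (1 - Polynomial.X) = laguerreSqBorel n := by
  rw [laguerreSqBorel, Polynomial.sum_comp, ← Finset.sum_range_reflect]
  refine Finset.sum_congr rfl fun l hl => ?_
  have hl' : l ≤ n := by simpa [Nat.lt_succ_iff] using hl
  have h₁ : n + 1 - 1 - l = n - l := by omega
  have h₂ : n - (n - l) = l := by omega
  simp only [h₁, h₂, Nat.choose_symm hl', Polynomial.pow_comp, Polynomial.mul_comp,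
    Polynomial.natCast_comp, Polynomial.neg_comp, Polynomial.X_comp, Polynomial.add_comp,
    Polynomial.one_comp]
  have h₃ : (1 + -(1 - Polynomial.X) : Polynomial ℝ) = Polynomial.X := by ring
  rw [h₃, neg_pow (1 - Polynomial.X : Polynomial ℝ), neg_pow (Polynomial.X : Polynomial ℝ) l]
  simp only [mul_pow, ← pow_mul, mul_comm _ 2, pow_mul (-1 : Polynomial ℝ) 2, neg_one_sq, one_pow]
  ring

theorem laguerreSqBorel_eq_sum (n : ℕ) :
    laguerreSqBorel n = ∑ i ∈ Finset.range (n + 1), ∑ j ∈ Finset.range (n + 1),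
      Polynomial.C ((n.choose i : ℝ) * n.choose j * (i + j).choose i * (-1) ^ (i + j)) *
        Polynomial.X ^ (i + j) := by
  have h : laguerreSqBorel n = ∑ l ∈ Finset.range (n + 1),
      (∑ i ∈ Finset.range (n + 1),
        (n.choose i * i.choose l : Polynomial ℝ) * (-Polynomial.X) ^ i) ^ 2 := by
    refine Finset.sum_congr rfl fun l hl => ?_
    rw [sum_choose_mul_choose_mul_pow (by simpa [Nat.lt_succ_iff] using hl)]
  simp_rw [h, sq, Finset.sum_mul_sum]
  rw [Finset.sum_comm]
  refine Finset.sum_congr rfl fun i hi => ?_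
  rw [Finset.sum_comm]
  refine Finset.sum_congr rfl fun j _ => ?_
  rw [add_choose_eq_sum_choose_mul_choose (n := n) (by simpa [Nat.lt_succ_iff] using hi) j]
  simp only [Nat.cast_sum, Nat.cast_mul, Finset.mul_sum, Finset.sum_mul, map_sum, map_mul,
    map_pow, map_neg, map_one, map_natCast]
  refine Finset.sum_congr rfl fun l _ => ?_
  rw [neg_pow (Polynomial.X : Polynomial ℝ) i, neg_pow (Polynomial.X : Polynomial ℝ) j]
  ring

theorem borelEval_laguerreSqBorel (n : ℕ) (t : ℝ) :
    borelEval t (laguerreSqBorel n) = laguerre n t ^ 2 := by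
  rw [laguerreSqBorel_eq_sum, laguerre, sq, Finset.sum_mul_sum, map_sum]
  refine Finset.sum_congr rfl fun i _ => ?_
  rw [map_sum]
  refine Finset.sum_congr rfl fun j _ => ?_
  rw [borelEval_C_mul_X_pow, Nat.cast_add_choose, neg_pow t i, neg_pow t j]
  field_simp
  ring

theorem integrableOn_mul_pow_mul_exp_neg_sq (j : ℕ) :
    IntegrableOn (fun x : ℝ => x * (x ^ 2 / 2) ^ j * exp (-x ^ 2 / 2)) (Set.Ioi 0) := by
  have h := integrableOn_rpow_mul_exp_neg_mul_sq (b := 1 / 2) (by norm_num)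
    (s := ((2 * j + 1 : ℕ) : ℝ)) (by push_cast; linarith [j.cast_nonneg (α := ℝ)])
  refine IntegrableOn.congr_fun (h.const_mul ((1 / 2) ^ j)) (fun x _ => ?_) measurableSet_Ioi
  simp only [rpow_natCast]
  rw [show -x ^ 2 / 2 = -(1 / 2) * x ^ 2 by ring]
  ring

theorem integral_mul_pow_mul_exp_neg_sq (j : ℕ) :
    ∫ x in Set.Ioi (0 : ℝ), x * (x ^ 2 / 2) ^ j * exp (-x ^ 2 / 2) = (j.factorial : ℝ) := by
  have hj : (0 : ℝ) ≤ j := j.cast_nonneg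
  have h := integral_rpow_mul_exp_neg_mul_rpow (p := 2) (b := 1 / 2) (q := ((2 * j + 1 : ℕ) : ℝ))
    two_pos (by push_cast; linarith) (by norm_num)
  have hq : (((2 * j + 1 : ℕ) : ℝ) + 1) / 2 = j + 1 := by push_cast; ring
  have hq' : -(((2 * j + 1 : ℕ) : ℝ) + 1) / 2 = -((j + 1 : ℕ) : ℝ) := by push_cast; ring
  rw [hq, hq', Real.Gamma_nat_eq_factorial, rpow_neg (by norm_num), rpow_natCast] at h
  calc ∫ x in Set.Ioi (0 : ℝ), x * (x ^ 2 / 2) ^ j * exp (-x ^ 2 / 2)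
      = ∫ x in Set.Ioi (0 : ℝ),
          (1 / 2) ^ j * (x ^ ((2 * j + 1 : ℕ) : ℝ) * exp (-(1 / 2) * x ^ (2 : ℝ))) := by
        refine setIntegral_congr_fun measurableSet_Ioi fun x _ => ?_
        simp only [rpow_natCast, rpow_two]
        rw [show -x ^ 2 / 2 = -(1 / 2) * x ^ 2 by ring]
        ring
    _ = j.factorial := by
        rw [integral_const_mul, h, pow_succ]
        field_simp

theorem hasSum_choose_mul_pow_div_factorial (j : ℕ) (y : ℝ) :
    HasSum (fun k : ℕ => (k.choose j : ℝ) * y ^ k / k.factorial)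
      (y ^ j / j.factorial * exp y) := by
  rw [← hasSum_nat_add_iff' j, Finset.sum_eq_zero, sub_zero]
  · have h := (NormedSpace.expSeries_div_hasSum_exp y).mul_left (y ^ j / (j.factorial : ℝ))
    rw [← Real.exp_eq_exp_ℝ] at h
    refine h.congr_fun fun k => ?_
    rw [Nat.cast_choose ℝ (Nat.le_add_left j k), Nat.add_sub_cancel, pow_add]
    field_simp
  · intro k hk
    rw [Nat.choose_eq_zero_of_lt (by simpa using hk)]
    simp

/-- Kummer's transformation for Laguerre polynomials. -/
theorem hasSum_add_choose_mul_pow_div_factorial (m : ℕ) (y : ℝ) :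
    HasSum (fun k : ℕ => ((m + k).choose m : ℝ) * y ^ k / k.factorial)
      (laguerre m (-y) * exp y) := by
  have h := hasSum_sum (s := Finset.range (m + 1)) fun j _ =>
    (hasSum_choose_mul_pow_div_factorial j y).mul_left (m.choose j : ℝ)
  have hsum : laguerre m (-y) * exp y = ∑ j ∈ Finset.range (m + 1),
      (m.choose j : ℝ) * (y ^ j / j.factorial * exp y) := by
    rw [laguerre, Finset.sum_mul]
    exact Finset.sum_congr rfl fun j _ => by rw [neg_neg]; ring
  rw [hsum]
  refine h.congr_fun fun k => ?_
  rw [add_choose_eq_sum_choose_mul_choose le_rfl]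
  push_cast
  rw [Finset.sum_mul, Finset.sum_div]
  exact Finset.sum_congr rfl fun j _ => by ring

/-- The `k`-th term of the expansion of `J₀(r x) x Φ_{x²/2}(p) e^{-x²/2}`, where `Φ_t` is
`borelEval t`. -/
noncomputable def hankelTerm (r : ℝ) (p : Polynomial ℝ) (k : ℕ) (x : ℝ) : ℝ :=
  (-1 : ℝ) ^ k / (k.factorial : ℝ) ^ 2 * (r * x / 2) ^ (2 * k) *
    (x * borelEval (x ^ 2 / 2) p * exp (-x ^ 2 / 2))

theorem hankelTerm_add (r : ℝ) (p q : Polynomial ℝ) (k : ℕ) :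
    hankelTerm r (p + q) k = hankelTerm r p k + hankelTerm r q k := by
  funext x
  simp only [hankelTerm, map_add, Pi.add_apply]
  ring

theorem hankelTerm_monomial (r : ℝ) (m : ℕ) (a : ℝ) (k : ℕ) (x : ℝ) :
    hankelTerm r (Polynomial.monomial m a) k x =
      a * (-(r ^ 2 / 2)) ^ k / ((k.factorial : ℝ) ^ 2 * m.factorial) *
        (x * (x ^ 2 / 2) ^ (m + k) * exp (-x ^ 2 / 2)) := by
  rw [hankelTerm, borelEval_monomial, neg_pow (r ^ 2 / 2), pow_mul (r * x / 2),
    show (r * x / 2) ^ 2 = r ^ 2 / 2 * (x ^ 2 / 2) by ring, mul_pow (r ^ 2 / 2), pow_add]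
  field_simp

theorem integrableOn_hankelTerm (r : ℝ) (p : Polynomial ℝ) (k : ℕ) :
    IntegrableOn (hankelTerm r p k) (Set.Ioi 0) := by
  induction p using Polynomial.induction_on' with
  | add p q hp hq => rw [hankelTerm_add]; exact hp.add hq
  | monomial m a =>
    rw [funext (hankelTerm_monomial r m a k)]
    exact (integrableOn_mul_pow_mul_exp_neg_sq (m + k)).const_mul _

theorem summable_integral_norm_hankelTerm (r : ℝ) (p : Polynomial ℝ) :
    Summable fun k => ∫ x in Set.Ioi (0 : ℝ), ‖hankelTerm r p k x‖ := by
  induction p using Polynomial.induction_on' with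
  | add p q hp hq =>
    refine (hp.add hq).of_nonneg_of_le (fun k => integral_nonneg fun x => norm_nonneg _)
      fun k => ?_
    have hp' := (integrableOn_hankelTerm r p k).norm
    have hq' := (integrableOn_hankelTerm r q k).norm
    rw [← integral_add hp' hq', hankelTerm_add]
    exact integral_mono ((integrableOn_hankelTerm r p k).add (integrableOn_hankelTerm r q k)).norm
      (hp'.add hq') fun x => norm_add_le _ _
  | monomial m a =>
    refine ((hasSum_add_choose_mul_pow_div_factorial m (r ^ 2 / 2)).summable.mul_left |a|).congr
      fun k => ?_
    have h : ∀ x ∈ Set.Ioi (0 : ℝ), ‖hankelTerm r (Polynomial.monomial m a) k x‖ =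
        |a| * (r ^ 2 / 2) ^ k / ((k.factorial : ℝ) ^ 2 * m.factorial) *
          (x * (x ^ 2 / 2) ^ (m + k) * exp (-x ^ 2 / 2)) := by
      intro x hx
      have hx' : 0 < x := hx
      have hr : 0 ≤ r ^ 2 / 2 := by positivity
      rw [hankelTerm_monomial, norm_mul, Real.norm_of_nonneg (r := x * _ * _) (by positivity),
        Real.norm_eq_abs, abs_div, abs_mul, abs_pow, abs_neg, abs_of_nonneg hr,
        abs_of_pos (a := (k.factorial : ℝ) ^ 2 * m.factorial) (by positivity)]
    rw [setIntegral_congr_fun measurableSet_Ioi h, integral_const_mul,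
      integral_mul_pow_mul_exp_neg_sq, Nat.cast_add_choose]
    field_simp

theorem hasSum_integral_hankelTerm (r : ℝ) (p : Polynomial ℝ) :
    HasSum (fun k => ∫ x in Set.Ioi (0 : ℝ), hankelTerm r p k x)
      (borelEval (r ^ 2 / 2) (p.comp (1 - Polynomial.X)) * exp (-r ^ 2 / 2)) := by
  induction p using Polynomial.induction_on' with
  | add p q hp hq =>
    rw [Polynomial.add_comp, map_add, add_mul]
    refine (hp.add hq).congr_fun fun k => ?_
    rw [hankelTerm_add]
    exact integral_add (integrableOn_hankelTerm r p k) (integrableOn_hankelTerm r q k)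
  | monomial m a =>
    have h := (hasSum_add_choose_mul_pow_div_factorial m (-(r ^ 2 / 2))).mul_left a
    rw [Polynomial.monomial_comp, ← Polynomial.smul_eq_C_mul, map_smul, borelEval_one_sub_X_pow,
      smul_eq_mul, mul_assoc]
    rw [neg_neg, ← neg_div] at h
    refine h.congr_fun fun k => ?_
    rw [funext (hankelTerm_monomial r m a k), integral_const_mul,
      integral_mul_pow_mul_exp_neg_sq, Nat.cast_add_choose, neg_div]
    field_simp

/-- The Hankel transform of order zero acts on Borel transforms of polynomials, weighted by a
Gaussian, through the substitution `X ↦ 1 - X`. -/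
theorem integral_besselJ0_mul_borelEval (r : ℝ) (p : Polynomial ℝ) :
    ∫ x in Set.Ioi (0 : ℝ),
        besselJ0 (r * x) * x * borelEval (x ^ 2 / 2) p * exp (-x ^ 2 / 2) =
      borelEval (r ^ 2 / 2) (p.comp (1 - Polynomial.X)) * exp (-r ^ 2 / 2) := by
  have h := hasSum_integral_of_summable_integral_norm (integrableOn_hankelTerm r p)
    (summable_integral_norm_hankelTerm r p)
  rw [← h.unique (hasSum_integral_hankelTerm r p)]
  refine integral_congr_ae (Filter.Eventually.of_forall fun x => ?_)
  simp only [hankelTerm, tsum_mul_right, besselJ0]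
  ring

/-- Fock-state MacWilliams identity (Laguerre–Hankel eigenfunction identity):
`∫_0^∞ J_0(rx)·x·L_n(x²/2)²·e^{−x²/2} dx = L_n(r²/2)²·e^{−r²/2}`, i.e. the weight
distribution of the `n`-th Fock state is a fixed point of the single-mode Bessel kernel. -/
theorem hankel_fock_fixed_point (n : ℕ) (r : ℝ) (hr : 0 ≤ r) :
    ∫ x in Set.Ioi (0 : ℝ),
        besselJ0 (r * x) * x * laguerre n (x ^ 2 / 2) ^ 2 * Real.exp (-x ^ 2 / 2) =
      laguerre n (r ^ 2 / 2) ^ 2 * Real.exp (-r ^ 2 / 2) := by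
  have h := integral_besselJ0_mul_borelEval r (laguerreSqBorel n)
  simpa only [laguerreSqBorel_comp_one_sub_X, borelEval_laguerreSqBorel] using h
end
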